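/- arXiv:1004.5527 — 3 statements merged into one kernel-verified Lean document; each statement's English description precedes it below -/
import Mathlib

section
/- Let k ≥ 2 be an integer, d a positive integer, and B ≥ 1 a real number. Then for every ε > 0, the number of pairs (x,y) ∈ ℤ² with |x| ≤ B, |y| ≤ B and x^k ≡ y^k (mod d) is O(B^{1+ε} + B^{2+ε} d^{ε - 2/k}), with implied constant depending only on k and ε. -/
open scoped BigOperators
open Real

/-- If a cyclic subgroup has index at most two, then for `k > 0` there are at most `2 * k`
elements whose `k`-th power is trivial. -/
lemma card_powMonoidHom_ker_le_two_mul {G : Type*} [CommGroup G] [Finite G] (g : G)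
    (hg : Nat.card G ≤ 2 * orderOf g) {k : ℕ} (hk : 0 < k) :
    Nat.card (powMonoidHom k : G →* G).ker ≤ 2 * k := by
  set H := Subgroup.zpowers g
  set T := (powMonoidHom k : G →* G).ker
  have hH : 0 < Nat.card H := Nat.card_pos
  have hidx : H.index ≤ 2 := by
    have h1 := H.card_mul_index
    have h2 : Nat.card H = orderOf g := Nat.card_zpowers g
    rw [← h2] at hg
    nlinarith
  have hrel : H.relIndex T ≤ 2 := by
    have := Subgroup.relIndex_le_of_le_right (H := H) (K := T) (L := ⊤) le_top
      (by rw [Subgroup.relIndex_top_right]; exact Subgroup.index_ne_zero_of_finite)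
    rw [Subgroup.relIndex_top_right] at this
    exact this.trans hidx
  have hcard : Nat.card (H ⊓ T : Subgroup G) * H.relIndex T = Nat.card T := by
    have h := Subgroup.relIndex_mul_relIndex ⊥ (H ⊓ T) T bot_le inf_le_right
    rwa [Subgroup.relIndex_bot_left, Subgroup.relIndex_bot_left,
      Subgroup.inf_relIndex_right] at h
  have hinf : Nat.card (H ⊓ T : Subgroup G) ≤ k := by
    have h : Nat.card (powMonoidHom k : H →* H).ker ≤ k := by
      rw [IsCyclic.card_powMonoidHom_ker]
      exact Nat.gcd_le_right _ hk
    refine le_trans (Nat.card_le_card_of_injective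
      (fun x : (H ⊓ T : Subgroup G) ↦ (⟨⟨x.1, x.2.1⟩, ?_⟩ : (powMonoidHom k : H →* H).ker)) ?_) h
    · exact Subtype.ext (show x.1 ^ k = 1 from x.2.2)
    · intro x y hxy
      exact Subtype.ext (congrArg (fun z ↦ (z.1.1 : G)) hxy)
  rw [← hcard, mul_comm 2 k]
  exact Nat.mul_le_mul hinf hrel

/-- The unit group of `ZMod (p ^ b)` has a cyclic subgroup of index at most two. -/
lemma exists_card_units_zmod_prime_pow_le {p : ℕ} (hp : p.Prime) (b : ℕ) :
    ∃ g : (ZMod (p ^ b))ˣ, Nat.card (ZMod (p ^ b))ˣ ≤ 2 * orderOf g := by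
  have hcyc (h : IsCyclic (ZMod (p ^ b))ˣ) :
      ∃ g : (ZMod (p ^ b))ˣ, Nat.card (ZMod (p ^ b))ˣ ≤ 2 * orderOf g := by
    obtain ⟨g, hg⟩ := isCyclic_iff_exists_orderOf_eq_natCard.mp h
    exact ⟨g, by lia⟩
  obtain rfl | hp2 := eq_or_ne p 2
  · obtain hb | hb := le_or_gt b 2
    · exact hcyc ((ZMod.isCyclic_units_two_pow_iff b).mpr hb)
    · obtain ⟨n, rfl⟩ : ∃ n, b = n + 2 := ⟨b - 2, by lia⟩
      have h5 : IsUnit (5 : ZMod (2 ^ (n + 2))) := by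
        have : IsUnit ((5 : ℕ) : ZMod (2 ^ (n + 2))) := by
          rw [ZMod.isUnit_iff_coprime]
          exact Nat.Coprime.pow_right _ (by norm_num)
        exact_mod_cast this
      refine ⟨h5.unit, ?_⟩
      rw [← orderOf_units, IsUnit.unit_spec, ZMod.orderOf_five, Nat.card_eq_fintype_card,
        ZMod.card_units_eq_totient, Nat.totient_prime_pow_succ Nat.prime_two]
      simp [pow_succ, mul_comm]
  · exact hcyc (ZMod.isCyclic_units_of_prime_pow p hp hp2 b)

/-- The solutions of `y ^ k ≡ x ^ k` modulo a prime power `p ^ b`, for `x` prime to `p`, lie in at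
most `2 * k` residue classes. -/
lemma exists_residues_of_not_dvd {p : ℕ} (hp : p.Prime) {b k : ℕ} (hb : b ≠ 0) (hk : 0 < k)
    {x : ℤ} (hx : ¬ (p : ℤ) ∣ x) :
    ∃ R : Finset ℤ, R.card ≤ 2 * k ∧
      ∀ y : ℤ, ((p ^ b : ℕ) : ℤ) ∣ x ^ k - y ^ k → ∃ r ∈ R, ((p ^ b : ℕ) : ℤ) ∣ y - r := by
  classical
  obtain ⟨g, hg⟩ := exists_card_units_zmod_prime_pow_le hp b
  have hpp : Prime (p : ℤ) := Nat.prime_iff_prime_int.mp hp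
  have hne : NeZero (p ^ b) := ⟨pow_ne_zero _ hp.ne_zero⟩
  have hunit (z : ℤ) (hz : ¬ (p : ℤ) ∣ z) : IsUnit (z : ZMod (p ^ b)) := by
    rw [ZMod.coe_int_isUnit_iff_isCoprime]
    push_cast
    exact ((hpp.coprime_iff_not_dvd).mpr hz).pow_left
  let T := (powMonoidHom k : (ZMod (p ^ b))ˣ →* (ZMod (p ^ b))ˣ).ker
  have : Fintype T := Fintype.ofFinite T
  refine ⟨Finset.univ.image fun t : T ↦ (((t.1 * (hunit x hx).unit : (ZMod (p ^ b))ˣ) :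
    ZMod (p ^ b)).val : ℤ), ?_, fun y hy ↦ ?_⟩
  · refine Finset.card_image_le.trans ?_
    rw [Finset.card_univ, ← Nat.card_eq_fintype_card]
    exact card_powMonoidHom_ker_le_two_mul g hg hk
  · have hy' : ¬ (p : ℤ) ∣ y := fun h ↦ hx <| hpp.dvd_of_dvd_pow (n := k) <| by
      have h1 : (p : ℤ) ∣ x ^ k - y ^ k :=
        (by exact_mod_cast dvd_pow_self p hb : (p : ℤ) ∣ ((p ^ b : ℕ) : ℤ)).trans hy
      exact (dvd_sub_left (dvd_pow h hk.ne')).mp h1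
    have hpow : (x : ZMod (p ^ b)) ^ k = (y : ZMod (p ^ b)) ^ k := by
      rw [← ZMod.intCast_zmod_eq_zero_iff_dvd] at hy
      push_cast at hy
      exact sub_eq_zero.mp hy
    refine ⟨_, Finset.mem_image_of_mem _ (Finset.mem_univ
      (⟨(hunit y hy').unit * (hunit x hx).unit⁻¹, ?_⟩ : T)), ?_⟩
    · rw [MonoidHom.mem_ker, powMonoidHom_apply, mul_pow, inv_pow, mul_inv_eq_one]
      ext
      simpa using hpow.symm
    · rw [← ZMod.intCast_zmod_eq_zero_iff_dvd]
      simp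

/-- Combining residue conditions modulo two coprime moduli. -/
lemma exists_residues_mul {P Q : ℤ → Prop} {m n : ℕ} (hmn : m.Coprime n) (R S : Finset ℤ)
    (hR : ∀ y, P y → ∃ r ∈ R, (m : ℤ) ∣ y - r) (hS : ∀ y, Q y → ∃ s ∈ S, (n : ℤ) ∣ y - s) :
    ∃ U : Finset ℤ, U.card ≤ R.card * S.card ∧
      ∀ y, P y → Q y → ∃ u ∈ U, ((m * n : ℕ) : ℤ) ∣ y - u := by
  classical
  obtain ⟨a, b, hab⟩ := Nat.isCoprime_iff_coprime.mpr hmn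
  refine ⟨(R ×ˢ S).image fun t ↦ t.1 * (b * n) + t.2 * (a * m), ?_, fun y hP hQ ↦ ?_⟩
  · exact Finset.card_image_le.trans (Finset.card_product R S).le
  · obtain ⟨r, hr, c, hc⟩ := hR y hP
    obtain ⟨s, hs, e, he⟩ := hS y hQ
    refine ⟨_, Finset.mem_image_of_mem _ (Finset.mk_mem_product hr hs), c * b + e * a, ?_⟩
    push_cast
    linear_combination (b * n) * hc + (a * m) * he - y * hab

/-- For fixed `x`, the solutions `y` of `y ^ k ≡ x ^ k` modulo `p ^ a` lie in few residue classes
modulo `m`, where `m` is large in terms of `gcd (x, p ^ a)`. -/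
lemma exists_residues_prime_pow {p : ℕ} (hp : p.Prime) {a k : ℕ} (ha : 0 < a) (hk : 2 ≤ k)
    (x : ℤ) :
    ∃ m : ℕ, m ∣ p ^ a ∧ (p ^ a) ^ 2 ≤ (x.gcd (p ^ a : ℕ) * m) ^ k ∧ ∃ R : Finset ℤ,
      R.card ≤ 2 * k ∧
      ∀ y : ℤ, ((p ^ a : ℕ) : ℤ) ∣ x ^ k - y ^ k → ∃ r ∈ R, (m : ℤ) ∣ y - r := by
  classical
  have hpp : Prime (p : ℤ) := Nat.prime_iff_prime_int.mp hp
  have hp0 : (p : ℤ) ≠ 0 := hpp.ne_zero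
  have hk0 : k ≠ 0 := by lia
  by_cases hx : ((p ^ a : ℕ) : ℤ) ∣ x ^ k
  · -- here both `x` and `y` are divisible by `p ^ ⌈a / k⌉`
    obtain ⟨e, he, hea⟩ : ∃ e, a ≤ k * e ∧ k * e < a + k :=
      ⟨(a + k - 1) / k, by
        have := Nat.div_add_mod (a + k - 1) k
        have := Nat.mod_lt (a + k - 1) (show 0 < k by lia)
        lia, by
        have := Nat.mul_div_le (a + k - 1) k
        lia⟩
    have hle : e ≤ a := by
      by_contra! h
      nlinarith
    have key (z : ℤ) (hz : ((p ^ a : ℕ) : ℤ) ∣ z ^ k) : ((p ^ e : ℕ) : ℤ) ∣ z := by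
      push_cast at hz ⊢
      by_cases hz0 : z = 0
      · simp [hz0]
      have hfin : FiniteMultiplicity (p : ℤ) z :=
        Int.finiteMultiplicity_iff.mpr ⟨by simpa using hp.ne_one, hz0⟩
      obtain ⟨w, hw, hnw⟩ := hfin.exists_eq_pow_mul_and_not_dvd
      set s := multiplicity (p : ℤ) z
      have h1 : a ≤ s * k := by
        by_contra! h
        rw [hw, mul_pow, ← pow_mul] at hz
        have h2 : (p : ℤ) ^ (s * k + 1) ∣ (p : ℤ) ^ (s * k) * w ^ k :=
          (pow_dvd_pow _ h).trans hz
        rw [pow_succ] at h2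
        exact hnw (hpp.dvd_of_dvd_pow ((mul_dvd_mul_iff_left (pow_ne_zero _ hp0)).mp h2))
      have h3 : e ≤ s := by
        by_contra! h
        nlinarith
      rw [hw]
      exact (pow_dvd_pow _ h3).mul_right _
    refine ⟨p ^ e, pow_dvd_pow _ hle, ?_, {0}, by simp; lia, fun y hy ↦ ⟨0, by simp, ?_⟩⟩
    · have hgcd : p ^ e ∣ x.gcd (p ^ a : ℕ) :=
        Int.dvd_gcd (key x hx) (by exact_mod_cast pow_dvd_pow p hle)
      have hpos : 0 < x.gcd (p ^ a : ℕ) := Int.gcd_pos_of_ne_zero_right _ (by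
        exact_mod_cast pow_ne_zero _ hp.ne_zero)
      calc (p ^ a) ^ 2 ≤ (p ^ (k * e)) ^ 2 := by gcongr; exact hp.one_le
        _ = (p ^ e * p ^ e) ^ k := by ring
        _ ≤ _ := by gcongr; exact Nat.le_of_dvd hpos hgcd
    · rw [sub_zero]
      exact key y ((dvd_sub_right hx).mp hy)
  · have hx0 : x ≠ 0 := by
      rintro rfl
      simp [hk0] at hx
    have hfin : FiniteMultiplicity (p : ℤ) x :=
      Int.finiteMultiplicity_iff.mpr ⟨by simpa using hp.ne_one, hx0⟩
    obtain ⟨w, hw, hnw⟩ := hfin.exists_eq_pow_mul_and_not_dvd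
    set s := multiplicity (p : ℤ) x
    have hsa : s * k < a := by
      by_contra! h
      refine hx ?_
      rw [hw, mul_pow, ← pow_mul]
      push_cast
      exact (pow_dvd_pow _ h).mul_right _
    obtain ⟨b, rfl⟩ : ∃ b, a = s * k + b := ⟨a - s * k, by lia⟩
    have hb : b ≠ 0 := by lia
    obtain ⟨R, hRc, hR⟩ := exists_residues_of_not_dvd hp hb (show 0 < k by lia) hnw
    have hsk : s ≤ s * k := Nat.le_mul_of_pos_right _ (by lia)
    refine ⟨p ^ (s + b), pow_dvd_pow _ (by lia), ?_, R.image ((p : ℤ) ^ s * ·),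
      Finset.card_image_le.trans hRc, fun y hy ↦ ?_⟩
    · have hgcd : p ^ s ∣ x.gcd (p ^ (s * k + b) : ℕ) := by
        refine Int.dvd_gcd ?_ (by exact_mod_cast pow_dvd_pow p (by lia))
        rw [hw]
        push_cast
        exact dvd_mul_right _ _
      have hpos : 0 < x.gcd (p ^ (s * k + b) : ℕ) := Int.gcd_pos_of_ne_zero_left _ hx0
      calc (p ^ (s * k + b)) ^ 2 = p ^ ((s * k + b) * 2) := by rw [pow_mul]
        _ ≤ p ^ ((s + (s + b)) * k) := Nat.pow_le_pow_right hp.pos (by nlinarith)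
        _ = (p ^ s * p ^ (s + b)) ^ k := by rw [pow_mul, pow_add]
        _ ≤ _ := by gcongr; exact Nat.le_of_dvd hpos hgcd
    · have hyk : (p : ℤ) ^ (s * k) ∣ y ^ k := by
        have h1 : (p : ℤ) ^ (s * k) ∣ x ^ k - y ^ k := by
          refine dvd_trans ?_ hy
          push_cast
          exact pow_dvd_pow _ (by lia)
        refine (dvd_sub_right ?_).mp h1
        rw [hw, mul_pow, ← pow_mul]
        exact dvd_mul_right _ _
      obtain ⟨z, rfl⟩ : (p : ℤ) ^ s ∣ y := by
        rwa [pow_mul, Int.pow_dvd_pow_iff hk0] at hyk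
      obtain ⟨r, hr, hdvd⟩ := hR z (by
        have h1 : (p : ℤ) ^ (s * k) * (p : ℤ) ^ b ∣ (p : ℤ) ^ (s * k) * (w ^ k - z ^ k) := by
          rw [hw] at hy
          convert! hy using 1
          · push_cast; ring
          · ring
        push_cast
        exact (mul_dvd_mul_iff_left (pow_ne_zero _ hp0)).mp h1)
      refine ⟨_, Finset.mem_image_of_mem _ hr, ?_⟩
      rw [← mul_sub]
      push_cast at hdvd ⊢
      rw [pow_add]
      exact mul_dvd_mul_left _ hdvd

/-- For fixed `x`, the solutions `y` of `y ^ k ≡ x ^ k` modulo `d` lie in few residue classes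
modulo `m`, where `m` is large in terms of `gcd (x, d)`. -/
lemma exists_residues {d k : ℕ} (hd : d ≠ 0) (hk : 2 ≤ k) (x : ℤ) :
    ∃ m : ℕ, m ∣ d ∧ d ^ 2 ≤ (x.gcd d * m) ^ k ∧ ∃ R : Finset ℤ,
      R.card ≤ d.divisors.card ^ (2 * k) ∧
      ∀ y : ℤ, (d : ℤ) ∣ x ^ k - y ^ k → ∃ r ∈ R, (m : ℤ) ∣ y - r := by
  induction d using Nat.recOnPosPrimePosCoprime with
  | zero => exact absurd rfl hd
  | one => exact ⟨1, one_dvd _, by simp, {0}, by simp, fun y _ ↦ ⟨0, by simp⟩⟩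
  | prime_pow p a hp ha =>
    obtain ⟨m, hm, hle, R, hR, h⟩ := exists_residues_prime_pow hp ha hk x
    refine ⟨m, hm, hle, R, hR.trans ?_, h⟩
    rw [Nat.divisors_prime_pow hp, Finset.card_map, Finset.card_range]
    calc 2 * k ≤ 2 ^ (2 * k) := Nat.lt_two_pow_self.le
      _ ≤ (a + 1) ^ (2 * k) := by gcongr; lia
  | coprime d₁ d₂ _ _ hcop ih₁ ih₂ =>
    obtain ⟨m, hm, hle₁, R, hR, h₁⟩ := ih₁ (by lia)
    obtain ⟨n, hn, hle₂, S, hS, h₂⟩ := ih₂ (by lia)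
    obtain ⟨U, hU, h⟩ := exists_residues_mul (hcop.of_dvd hm hn) R S h₁ h₂
    refine ⟨m * n, mul_dvd_mul hm hn, ?_, U, hU.trans ?_, fun y hy ↦ h y ?_ ?_⟩
    · have hgcd : x.gcd (d₁ * d₂ : ℕ) = x.gcd d₁ * x.gcd d₂ := by
        simp only [Int.gcd, Int.natAbs_natCast]
        exact hcop.gcd_mul x.natAbs
      calc (d₁ * d₂) ^ 2 = d₁ ^ 2 * d₂ ^ 2 := mul_pow ..
        _ ≤ (x.gcd d₁ * m) ^ k * (x.gcd d₂ * n) ^ k := Nat.mul_le_mul hle₁ hle₂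
        _ = _ := by rw [hgcd]; ring
    · rw [hcop.card_divisors_mul, mul_pow]
      exact Nat.mul_le_mul hR hS
    · exact dvd_trans (by push_cast; exact dvd_mul_right _ _) hy
    · exact dvd_trans (by push_cast; exact dvd_mul_left _ _) hy

/-- The number of integers in `[-M, M]` in a given residue class modulo `m`. -/
lemma card_filter_dvd_sub_le (M m : ℕ) (r : ℤ) :
    ((Finset.Icc (-M : ℤ) M).filter fun y ↦ (m : ℤ) ∣ y - r).card ≤ 2 * M / m + 1 := by
  rw [← Finset.card_range (2 * M / m + 1)]
  refine Finset.card_le_card_of_injOn (fun y ↦ (y + M).toNat / m) (fun y hy ↦ ?_)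
    fun y hy z hz hyz ↦ ?_
  · simp only [Finset.coe_filter, Finset.mem_Icc, Set.mem_ofPred_eq] at hy
    simp only [Finset.coe_range, Set.mem_Iio, Order.lt_add_one_iff]
    exact Nat.div_le_div_right (by lia)
  · simp only [Finset.coe_filter, Finset.mem_Icc, Set.mem_ofPred_eq] at hy hz
    have hdvd : (m : ℤ) ∣ (y + M) - (z + M) := by
      convert! dvd_sub hy.2 hz.2 using 1
      ring
    have hmod : (y + M) % m = (z + M) % m := Int.emod_eq_emod_iff_emod_sub_eq_zero.mpr
      (Int.emod_eq_zero_of_dvd hdvd)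
    have hdiv : (y + M) / m = (z + M) / m := by
      have h : (((y + M).toNat / m : ℕ) : ℤ) = ((z + M).toNat / m : ℕ) := by exact_mod_cast hyz
      push_cast at h
      rwa [Int.toNat_of_nonneg (by lia), Int.toNat_of_nonneg (by lia)] at h
    have h1 := Int.mul_ediv_add_emod (y + M) m
    have h2 := Int.mul_ediv_add_emod (z + M) m
    rw [hmod, hdiv] at h1
    linarith

/-- The sum of `gcd (x, d)` over the nonzero integers in `[-M, M]`. -/
lemma sum_gcd_le (M : ℕ) {d : ℕ} (hd : d ≠ 0) :
    ∑ x ∈ (Finset.Icc (-M : ℤ) M).erase 0, x.gcd d ≤ 2 * M * d.divisors.card := by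
  have hgcd (x : ℤ) : x.gcd d ≤ ∑ u ∈ d.divisors, if (u : ℤ) ∣ x then u else 0 := by
    have hmem : x.gcd d ∈ d.divisors :=
      Nat.mem_divisors.mpr ⟨by exact_mod_cast Int.gcd_dvd_right x d, hd⟩
    refine le_trans ?_ (Finset.single_le_sum (fun _ _ ↦ Nat.zero_le _) hmem)
    rw [if_pos (Int.gcd_dvd_left x d)]
  calc ∑ x ∈ (Finset.Icc (-M : ℤ) M).erase 0, x.gcd d
      ≤ ∑ x ∈ (Finset.Icc (-M : ℤ) M).erase 0, ∑ u ∈ d.divisors, if (u : ℤ) ∣ x then u else 0 :=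
        Finset.sum_le_sum fun x _ ↦ hgcd x
    _ = ∑ u ∈ d.divisors, ∑ x ∈ (Finset.Icc (-M : ℤ) M).erase 0, if (u : ℤ) ∣ x then u else 0 :=
        Finset.sum_comm
    _ ≤ ∑ _u ∈ d.divisors, 2 * M := by
        refine Finset.sum_le_sum fun u _ ↦ ?_
        rw [← Finset.sum_filter, Finset.sum_const, smul_eq_mul, Finset.filter_erase,
          Finset.card_erase_of_mem (by simp)]
        have h := card_filter_dvd_sub_le M u 0
        simp only [sub_zero] at h
        exact (Nat.mul_le_mul_right u (by lia)).trans (Nat.div_mul_le_self (2 * M) u)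
    _ = 2 * M * d.divisors.card := by rw [Finset.sum_const, smul_eq_mul, mul_comm]

/-- The divisor bound: the number of divisors of `n` is `O(n ^ ε)`. -/
lemma exists_card_divisors_le_mul_rpow {ε : ℝ} (hε : 0 < ε) :
    ∃ C : ℝ, 1 ≤ C ∧ ∀ n : ℕ, n ≠ 0 → (n.divisors.card : ℝ) ≤ C * (n : ℝ) ^ ε := by
  have hl : 0 < log 2 := log_pos one_lt_two
  set K : ℝ := 1 + 1 / (ε * log 2)
  have hK : 1 ≤ K := le_add_of_nonneg_right (by positivity)
  obtain ⟨P, hP⟩ := exists_nat_ge ((2 : ℝ) ^ (1 / ε))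
  have hlocal (p a : ℕ) (hp : p.Prime) :
      (a + 1 : ℝ) ≤ (if p < P then K else 1) * ((p : ℝ) ^ a) ^ ε := by
    have hp2 : (2 : ℝ) ≤ p := by exact_mod_cast hp.two_le
    split_ifs with h
    · calc (a + 1 : ℝ) ≤ K * (a * (ε * log 2) + 1) := by
            have h1 : 1 / (ε * log 2) * (a * (ε * log 2)) = a := by field_simp
            have h2 : 0 ≤ a * (ε * log 2) := by positivity
            have h3 : 0 ≤ 1 / (ε * log 2) := by positivity
            simp only [K]
            nlinarith
        _ ≤ K * exp (a * (ε * log 2)) := by gcongr; exact add_one_le_exp _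
        _ = K * ((2 : ℝ) ^ a) ^ ε := by
            rw [← rpow_natCast, ← rpow_mul zero_le_two, rpow_def_of_pos two_pos]
            congr 2; ring
        _ ≤ _ := by gcongr
    · have h2p : 2 ≤ (p : ℝ) ^ ε := by
        have hPp : (P : ℝ) ≤ p := by exact_mod_cast not_lt.mp h
        calc (2 : ℝ) = ((2 : ℝ) ^ (1 / ε)) ^ ε := by
              rw [← rpow_mul zero_le_two, one_div_mul_cancel hε.ne', rpow_one]
          _ ≤ _ := by gcongr; exact hP.trans hPp
      calc (a + 1 : ℝ) ≤ 2 ^ a := by exact_mod_cast Nat.lt_two_pow_self (n := a)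
        _ ≤ ((p : ℝ) ^ ε) ^ a := by gcongr
        _ = _ := by rw [one_mul, ← rpow_natCast, ← rpow_natCast, ← rpow_mul (by positivity),
              ← rpow_mul (by positivity), mul_comm]
  refine ⟨K ^ P, one_le_pow₀ hK, fun n hn ↦ ?_⟩
  have hprod : (n : ℝ) = ∏ p ∈ n.primeFactors, (p : ℝ) ^ n.factorization p := by
    conv_lhs => rw [← Nat.prod_factorization_pow_eq_self hn]
    simp [Finsupp.prod]
  rw [Nat.card_divisors hn]
  push_cast
  calc ∏ p ∈ n.primeFactors, (n.factorization p + 1 : ℝ)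
      ≤ ∏ p ∈ n.primeFactors,
          (if p < P then K else 1) * ((p : ℝ) ^ n.factorization p) ^ ε :=
        Finset.prod_le_prod (fun _ _ ↦ by positivity)
          fun p hp ↦ hlocal p _ (Nat.prime_of_mem_primeFactors hp)
    _ = K ^ (n.primeFactors.filter (· < P)).card * (n : ℝ) ^ ε := by
        rw [Finset.prod_mul_distrib, finsetProd_rpow _ _ (fun _ _ ↦ by positivity), ← hprod,
          Finset.prod_ite, Finset.prod_const, Finset.prod_const_one, mul_one]
    _ ≤ K ^ P * (n : ℝ) ^ ε := by
        gcongr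
        refine (Finset.card_le_card (t := Finset.range P) fun p hp ↦ ?_).trans
          (Finset.card_range P).le
        simpa using (Finset.mem_filter.mp hp).2

/-- The number of solutions `y ∈ [-M, M]` of `y ^ k ≡ x ^ k (mod d)` for fixed `x`. -/
lemma card_filter_dvd_pow_sub_pow_le {d k : ℕ} (hd : d ≠ 0) (hk : 2 ≤ k) (M : ℕ) (x : ℤ) :
    (((Finset.Icc (-M : ℤ) M).filter fun y ↦ (d : ℤ) ∣ x ^ k - y ^ k).card : ℝ) ≤
      (d.divisors.card : ℝ) ^ (2 * k) * (2 * M * x.gcd d * (d : ℝ) ^ (-(2 / k : ℝ)) + 1) := by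
  classical
  obtain ⟨m, hmd, hle, R, hR, h⟩ := exists_residues hd hk x
  have hm : 0 < m := Nat.pos_of_dvd_of_pos hmd (Nat.pos_of_ne_zero hd)
  have hk0 : (k : ℝ) ≠ 0 := by positivity
  have hd0 : (0 : ℝ) < d := by positivity
  have hmge : (d : ℝ) ^ (2 / k : ℝ) ≤ x.gcd d * m := by
    calc (d : ℝ) ^ (2 / k : ℝ) = ((d : ℝ) ^ 2) ^ (1 / k : ℝ) := by
          rw [← rpow_natCast, ← rpow_mul hd0.le]; congr 1; push_cast; ring
      _ ≤ ((x.gcd d * m : ℝ) ^ k) ^ (1 / k : ℝ) := by gcongr; exact_mod_cast hle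
      _ = x.gcd d * m := by
          rw [one_div, pow_rpow_inv_natCast (by positivity) (by lia)]
  have hcard : ((Finset.Icc (-M : ℤ) M).filter fun y ↦ (d : ℤ) ∣ x ^ k - y ^ k).card ≤
      d.divisors.card ^ (2 * k) * (2 * M / m + 1) := by
    calc _ ≤ (R.biUnion fun r ↦ (Finset.Icc (-M : ℤ) M).filter fun y ↦ (m : ℤ) ∣ y - r).card := by
          refine Finset.card_le_card fun y hy ↦ ?_
          obtain ⟨hy1, hy2⟩ := Finset.mem_filter.mp hy
          obtain ⟨r, hr, hry⟩ := h y hy2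
          exact Finset.mem_biUnion.mpr ⟨r, hr, Finset.mem_filter.mpr ⟨hy1, hry⟩⟩
      _ ≤ R.card * (2 * M / m + 1) :=
          Finset.card_biUnion_le_card_mul _ _ _ fun r _ ↦ card_filter_dvd_sub_le M m r
      _ ≤ _ := Nat.mul_le_mul_right _ hR
  have hdiv : ((2 * M / m : ℕ) : ℝ) ≤ 2 * M * x.gcd d * (d : ℝ) ^ (-(2 / k : ℝ)) := by
    refine Nat.cast_div_le.trans ?_
    rw [rpow_neg hd0.le, ← div_eq_mul_inv, div_le_div_iff₀ (by positivity) (by positivity)]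
    push_cast
    rw [mul_assoc (2 * (M : ℝ))]
    gcongr
  calc _ ≤ ((d.divisors.card ^ (2 * k) * (2 * M / m + 1) : ℕ) : ℝ) := by exact_mod_cast hcard
    _ = (d.divisors.card : ℝ) ^ (2 * k) * ((2 * M / m : ℕ) + 1) := by push_cast; ring
    _ ≤ _ := by gcongr

/-- The number of pairs in `[-M, M]²` with `x ^ k ≡ y ^ k (mod d)`, in terms of the number of
divisors of `d`. -/
lemma card_pairs_le {d k : ℕ} (hd : d ≠ 0) (hk : 2 ≤ k) {M : ℕ} (hM : 1 ≤ M) :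
    (((Finset.Icc (-M : ℤ) M ×ˢ Finset.Icc (-M : ℤ) M).filter
      fun p ↦ (d : ℤ) ∣ p.1 ^ k - p.2 ^ k).card : ℝ) ≤
      5 * (d.divisors.card : ℝ) ^ (2 * k + 1) * (M + M ^ 2 * (d : ℝ) ^ (-(2 / k : ℝ))) := by
  set I := Finset.Icc (-M : ℤ) M
  set F : ℝ := (d.divisors.card : ℝ) ^ (2 * k)
  set D : ℝ := (d : ℝ) ^ (-(2 / k : ℝ))
  have hτ : (1 : ℝ) ≤ d.divisors.card := by
    exact_mod_cast Finset.card_pos.mpr ⟨1, Nat.one_mem_divisors.mpr hd⟩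
  have hF : 1 ≤ F := one_le_pow₀ hτ
  have hD : 0 ≤ D := by positivity
  have hM' : (1 : ℝ) ≤ M := by exact_mod_cast hM
  have h0 : (0 : ℤ) ∈ I := by simp [I]
  have hI : I.card = 2 * M + 1 := by simp only [I, Int.card_Icc]; lia
  have hfiber : ((I ×ˢ I).filter fun p ↦ (d : ℤ) ∣ p.1 ^ k - p.2 ^ k).card =
      ∑ x ∈ I, (I.filter fun y ↦ (d : ℤ) ∣ x ^ k - y ^ k).card := by
    simp only [Finset.card_filter]
    exact Finset.sum_product ..
  have hgcd : (∑ x ∈ I.erase 0, (x.gcd d : ℝ)) ≤ 2 * M * d.divisors.card := by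
    exact_mod_cast sum_gcd_le M hd
  have hzero : ((I.filter fun y ↦ (d : ℤ) ∣ 0 ^ k - y ^ k).card : ℝ) ≤ 2 * M + 1 := by
    exact_mod_cast (Finset.card_filter_le _ _).trans hI.le
  rw [hfiber, ← Finset.add_sum_erase I _ h0]
  push_cast
  calc _ ≤ (2 * M + 1 : ℝ) + ∑ x ∈ I.erase 0, F * (2 * M * x.gcd d * D + 1) :=
        add_le_add hzero (Finset.sum_le_sum fun x _ ↦ card_filter_dvd_pow_sub_pow_le hd hk M x)
    _ = (2 * M + 1 : ℝ) + F * (2 * M * D * (∑ x ∈ I.erase 0, (x.gcd d : ℝ)) + 2 * M) := by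
        rw [← Finset.mul_sum, Finset.sum_add_distrib, Finset.sum_const,
          Finset.card_erase_of_mem h0, hI, Finset.mul_sum]
        simp only [Nat.add_sub_cancel, nsmul_eq_mul, mul_one]
        push_cast
        congr 3
        exact Finset.sum_congr rfl fun _ _ ↦ by ring
    _ ≤ (2 * M + 1 : ℝ) + F * (2 * M * D * (2 * M * d.divisors.card) + 2 * M) := by gcongr
    _ ≤ 5 * (F * d.divisors.card) * (M + M ^ 2 * D) := by
        have h1 : (M : ℝ) ≤ F * M := le_mul_of_one_le_left (by positivity) hF
        have h2 : F * M ≤ F * M * d.divisors.card := le_mul_of_one_le_right (by positivity) hτ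
        have h3 : 0 ≤ F * M ^ 2 * D * d.divisors.card := by positivity
        nlinarith
    _ = _ := by rw [pow_succ _ (2 * k)]

/-- For `d` large, the congruence `x ^ k ≡ y ^ k (mod d)` forces `y = ± x`. -/
lemma card_pairs_le_of_lt {d k : ℕ} (hk : k ≠ 0) {M : ℕ} (hM : 1 ≤ M) (hd : 2 * M ^ k < d) :
    ((Finset.Icc (-M : ℤ) M ×ˢ Finset.Icc (-M : ℤ) M).filter
      fun p ↦ (d : ℤ) ∣ p.1 ^ k - p.2 ^ k).card ≤ 6 * M := by
  classical
  set I := Finset.Icc (-M : ℤ) M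
  have hI : I.card = 2 * M + 1 := by simp only [I, Int.card_Icc]; lia
  have hbound (z : ℤ) (hz : z ∈ I) : |z ^ k| ≤ (M : ℤ) ^ k := by
    rw [abs_pow]
    exact pow_le_pow_left₀ (abs_nonneg z) (abs_le.mpr (Finset.mem_Icc.mp hz)) k
  calc _ ≤ (I.image (fun x ↦ (x, x)) ∪ I.image (fun x ↦ (x, -x))).card := by
        refine Finset.card_le_card fun p hp ↦ ?_
        obtain ⟨hp1, hp2⟩ := Finset.mem_filter.mp hp
        obtain ⟨hx, hy⟩ := Finset.mem_product.mp hp1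
        have heq : p.1 ^ k - p.2 ^ k = 0 := by
          refine Int.eq_zero_of_abs_lt_dvd hp2 ?_
          have h1 := abs_sub (p.1 ^ k) (p.2 ^ k)
          have h2 : (2 * (M : ℤ) ^ k) < d := by exact_mod_cast hd
          linarith [hbound _ hx, hbound _ hy]
        have habs : |p.1| = |p.2| := by
          rw [← pow_left_inj₀ (abs_nonneg _) (abs_nonneg _) hk, ← abs_pow, ← abs_pow,
            sub_eq_zero.mp heq]
        obtain ⟨x, y⟩ := p
        rcases abs_eq_abs.mp habs with h | h
        · simp_all
        · simp_all
    _ ≤ I.card + I.card :=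
        (Finset.card_union_le _ _).trans (add_le_add Finset.card_image_le Finset.card_image_le)
    _ ≤ 6 * M := by lia

/-- The number of pairs `(x,y)` with `|x|,|y| ≤ B` and `x^k ≡ y^k (mod d)` is
`O(B^(1+ε) + B^(2+ε) d^(ε-2/k))`, the implied constant depending only on `k` and `ε`. -/
theorem stmt_1 (k : ℕ) (hk : 2 ≤ k) (ε : ℝ) (hε : 0 < ε) :
    ∃ C : ℝ, 0 < C ∧ ∀ d : ℕ, 0 < d → ∀ B : ℝ, 1 ≤ B →
      (Nat.card {p : ℤ × ℤ | (|p.1| : ℝ) ≤ B ∧ (|p.2| : ℝ) ≤ B ∧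
          (d : ℤ) ∣ (p.1 ^ k - p.2 ^ k)} : ℝ)
        ≤ C * (B ^ (1 + ε) + B ^ (2 + ε) * (d : ℝ) ^ (ε - 2 / k)) := by
  classical
  have hk0 : (0 : ℝ) < k := by positivity
  have hk1 : (1 : ℝ) ≤ k := by exact_mod_cast (by lia : 1 ≤ k)
  set η : ℝ := ε / k
  have hη : 0 < η := by positivity
  have hηε : η ≤ ε := div_le_self hε.le hk1
  obtain ⟨A, hA, hτ⟩ := exists_card_divisors_le_mul_rpow (ε := η / (2 * k + 1 : ℕ)) (by positivity)
  have hτ' (d : ℕ) (hd : d ≠ 0) :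
      (d.divisors.card : ℝ) ^ (2 * k + 1) ≤ A ^ (2 * k + 1) * (d : ℝ) ^ η := by
    calc _ ≤ (A * (d : ℝ) ^ (η / (2 * k + 1 : ℕ))) ^ (2 * k + 1) := by gcongr; exact hτ d hd
      _ = _ := by
        rw [mul_pow, ← rpow_natCast ((d : ℝ) ^ _), ← rpow_mul (by positivity),
          div_mul_cancel₀ _ (by positivity)]
  set A' : ℝ := A ^ (2 * k + 1)
  have hA' : 1 ≤ A' := one_le_pow₀ hA
  have h2η : 1 ≤ (2 : ℝ) ^ η := one_le_rpow one_le_two hη.le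
  refine ⟨6 * A' * 2 ^ η, by positivity, fun d hd B hB ↦ ?_⟩
  have hd1 : (1 : ℝ) ≤ d := by exact_mod_cast hd
  have hB0 : 0 < B := by linarith
  set M := ⌊B⌋₊
  have hM : 1 ≤ M := Nat.one_le_floor_iff _ |>.mpr hB
  have hMB : (M : ℝ) ≤ B := Nat.floor_le hB0.le
  have hmem (z : ℤ) : (|z| : ℝ) ≤ B ↔ z ∈ Finset.Icc (-M : ℤ) M := by
    have h : (|z| : ℝ) = (z.natAbs : ℝ) := by rw [Nat.cast_natAbs, Int.cast_abs]
    rw [h, ← Nat.le_floor_iff hB0.le, Finset.mem_Icc]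
    lia
  have hset : {p : ℤ × ℤ | (|p.1| : ℝ) ≤ B ∧ (|p.2| : ℝ) ≤ B ∧ (d : ℤ) ∣ (p.1 ^ k - p.2 ^ k)} =
      ((Finset.Icc (-M : ℤ) M ×ˢ Finset.Icc (-M : ℤ) M).filter
        fun p ↦ (d : ℤ) ∣ p.1 ^ k - p.2 ^ k : Finset (ℤ × ℤ)) := by
    ext p
    simp only [Set.mem_ofPred_eq, hmem, Finset.coe_filter, Finset.mem_product, and_assoc]
  rw [hset, Nat.card_coe_set_eq, Set.ncard_coe_finset]
  have hBε : B ≤ B ^ (1 + ε) := by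
    conv_lhs => rw [← rpow_one B]
    exact rpow_le_rpow_of_exponent_le hB (by linarith)
  have hAη : 1 ≤ A' * 2 ^ η := one_le_mul_of_one_le_of_one_le hA' h2η
  obtain hlt | hle := lt_or_ge (2 * M ^ k) d
  · calc _ ≤ (6 : ℝ) * M := by exact_mod_cast card_pairs_le_of_lt (by lia) hM hlt
      _ ≤ 6 * B ^ (1 + ε) := by gcongr; exact hMB.trans hBε
      _ ≤ (A' * 2 ^ η) * (6 * B ^ (1 + ε)) := le_mul_of_one_le_left (by positivity) hAη
      _ = 6 * A' * 2 ^ η * (B ^ (1 + ε) + 0) := by ring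
      _ ≤ _ := by gcongr; positivity
  · have hdη : (d : ℝ) ^ η ≤ 2 ^ η * B ^ ε := by
      calc (d : ℝ) ^ η ≤ (2 * B ^ k) ^ η := by
            gcongr
            calc (d : ℝ) ≤ 2 * (M : ℝ) ^ k := by exact_mod_cast hle
              _ ≤ 2 * B ^ k := by gcongr
        _ = 2 ^ η * B ^ ε := by
            rw [mul_rpow zero_le_two (by positivity), ← rpow_natCast, ← rpow_mul hB0.le,
              mul_div_cancel₀ _ hk0.ne']
    have hfirst : (d : ℝ) ^ η * B ≤ 2 ^ η * B ^ (1 + ε) := by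
      calc _ ≤ 2 ^ η * B ^ ε * B := by gcongr
        _ = _ := by rw [rpow_add hB0, rpow_one]; ring
    have hsecond : (d : ℝ) ^ η * (B ^ 2 * (d : ℝ) ^ (-(2 / k : ℝ))) ≤
        2 ^ η * (B ^ (2 + ε) * (d : ℝ) ^ (ε - 2 / k)) := by
      calc _ ≤ (d : ℝ) ^ ε * (B ^ (2 + ε) * (d : ℝ) ^ (-(2 / k : ℝ))) := by
            gcongr
            rw [← rpow_natCast]
            exact rpow_le_rpow_of_exponent_le hB (by push_cast; linarith)
        _ = B ^ (2 + ε) * (d : ℝ) ^ (ε - 2 / k) := by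
            rw [sub_eq_add_neg, rpow_add (zero_lt_one.trans_le hd1)]; ring
        _ ≤ _ := le_mul_of_one_le_left (by positivity) h2η
    calc _ ≤ 5 * (d.divisors.card : ℝ) ^ (2 * k + 1) *
          (M + M ^ 2 * (d : ℝ) ^ (-(2 / k : ℝ))) := card_pairs_le hd.ne' hk hM
      _ ≤ 5 * (A' * (d : ℝ) ^ η) * (B + B ^ 2 * (d : ℝ) ^ (-(2 / k : ℝ))) := by
          gcongr
          exact hτ' d hd.ne'
      _ = 5 * A' * ((d : ℝ) ^ η * B + (d : ℝ) ^ η * (B ^ 2 * (d : ℝ) ^ (-(2 / k : ℝ)))) := by ring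
      _ ≤ 5 * A' * (2 ^ η * B ^ (1 + ε) + 2 ^ η * (B ^ (2 + ε) * (d : ℝ) ^ (ε - 2 / k))) := by
          gcongr
      _ = 5 * A' * 2 ^ η * (B ^ (1 + ε) + B ^ (2 + ε) * (d : ℝ) ^ (ε - 2 / k)) := by ring
      _ ≤ _ := by gcongr; norm_num
end

section
/- Let k ≥ 2 and s > 2k be integers, and let η > 0. Then there exists a constant c = c(k,s,η) > 0 such that for all A ≥ 1, the number of vectors a ∈ ℤ^s with all coordinates nonzero, max_j |a_j| ≤ A, for which the equation a_1 x_1^k + ... + a_s x_s^k = 0 has an integer solution with 0 < max_j |x_j| ≤ c·(max_j |a_j|)^{1/(s-k)}, does not exceed η A^s. -/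
open scoped BigOperators
open Real

/-- A linear form over `ZMod n` that represents `1` has exactly `n ^ (m - 1)` zeros. -/
lemma card_zeros_linearForm_zmod {ι : Type*} [Fintype ι] (n : ℕ) [NeZero n] (w b : ι → ZMod n)
    (hb : ∑ i, b i * w i = 1) :
    Nat.card {r : ι → ZMod n // ∑ i, r i * w i = 0} * n = n ^ Fintype.card ι := by
  let f : (ι → ZMod n) →ₗ[ZMod n] ZMod n := Fintype.linearCombination (ZMod n) w
  have hf : ∀ r, f r = ∑ i, r i * w i := fun r => by
    simp [f, Fintype.linearCombination_apply]
  have hsurj : Function.Surjective f := fun t => ⟨t • b, by rw [map_smul, hf, hb]; simp⟩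
  have h1 := f.toAddMonoidHom.ker.card_mul_index
  rw [AddSubgroup.index_ker, AddMonoidHom.range_eq_top.2 hsurj] at h1
  have h2 : Nat.card f.toAddMonoidHom.ker = Nat.card {r : ι → ZMod n // ∑ i, r i * w i = 0} :=
    Nat.card_congr (Equiv.subtypeEquivRight fun r => by
      rw [AddMonoidHom.mem_ker, ← hf]; rfl)
  rw [h2] at h1
  rw [Nat.card_fun] at h1
  simpa using h1

/-- The number of integer vectors in a box on which a primitive linear form is divisible
by `n`. -/
lemma card_box_dvd_linearForm_le {ι : Type*} [Fintype ι] (n N : ℕ) (hn : 0 < n) (hnN : n ≤ N)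
    (w b : ι → ℤ) (hb : (n : ℤ) ∣ ∑ i, b i * w i - 1) :
    {a : ι → ℤ | (∀ i, |a i| ≤ N) ∧ (n : ℤ) ∣ ∑ i, a i * w i}.ncard * n
      ≤ (4 * N) ^ Fintype.card ι := by
  classical
  have : NeZero n := ⟨hn.ne'⟩
  have hbz : ∑ i, ((b i : ℤ) : ZMod n) * (w i : ZMod n) = 1 := by
    have := (ZMod.intCast_zmod_eq_zero_iff_dvd _ n).2 hb
    push_cast at this
    exact sub_eq_zero.1 this
  have hcard := card_zeros_linearForm_zmod n (fun i => (w i : ZMod n)) (fun i => (b i : ZMod n)) hbz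
  set R := {r : ι → ZMod n // ∑ i, r i * (w i : ZMod n) = 0}
  set S := {a : ι → ℤ | (∀ i, |a i| ≤ N) ∧ (n : ℤ) ∣ ∑ i, a i * w i}
  let Q := ι → Finset.Icc (-((N / n : ℕ) : ℤ) - 1) ((N / n : ℕ) : ℤ)
  have hn' : (0 : ℤ) < n := by exact_mod_cast hn
  let F : S → R × Q := fun a =>
    (⟨fun i => (a.1 i : ZMod n), by
      have := (ZMod.intCast_zmod_eq_zero_iff_dvd _ n).2 a.2.2
      push_cast at this
      exact this⟩,
     fun i => ⟨a.1 i / n, by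
      have h := abs_le.1 (a.2.1 i)
      rw [Finset.mem_Icc]
      push_cast
      constructor
      · rw [Int.le_ediv_iff_mul_le hn']
        have := Int.lt_ediv_add_one_mul_self (N : ℤ) hn'
        linarith
      · exact Int.ediv_le_ediv hn' h.2⟩)
  have hF : Function.Injective F := by
    intro a a' h
    ext i
    have h1 := congrFun (congrArg (fun p => p.1.1) h) i
    have h2 := congrArg Subtype.val (congrFun (congrArg Prod.snd h) i)
    simp only [F] at h1 h2
    have h3 := (ZMod.intCast_eq_intCast_iff' _ _ _).1 h1
    rw [← Int.mul_ediv_add_emod (a.1 i) n, ← Int.mul_ediv_add_emod (a'.1 i) n, h2, h3]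
  have hle := Nat.card_le_card_of_injective F hF
  rw [Nat.card_prod] at hle
  have hQ : Nat.card Q = (2 * (N / n) + 2) ^ Fintype.card ι := by
    simp only [Q, Nat.card_eq_fintype_card, Fintype.card_fun, Fintype.card_coe, Int.card_Icc]
    congr 1
    omega
  have h1 : 1 ≤ N / n := Nat.div_pos hnN hn
  calc S.ncard * n ≤ Nat.card R * Nat.card Q * n := Nat.mul_le_mul_right _ hle
    _ = (n * (2 * (N / n) + 2)) ^ Fintype.card ι := by
      rw [mul_right_comm, hcard, hQ, mul_pow]
    _ ≤ _ := by
      refine Nat.pow_le_pow_left ?_ _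
      nlinarith [Nat.mul_div_le N n]

/-- The number of coefficient vectors in a box for which a given primitive `x` solves the
diagonal equation. -/
lemma card_coeff_of_primitive_le {m : ℕ} (k N h : ℕ) (hh : 0 < h) (hN : h ^ k ≤ N)
    (x : Fin (m + 1) → ℤ) (j : Fin (m + 1)) (hxj : |x j| = h)
    (hx : Ideal.span (Set.range x) = ⊤) :
    {a : Fin (m + 1) → ℤ | (∀ i, |a i| ≤ N) ∧ ∑ i, a i * x i ^ k = 0}.ncard * h ^ k
      ≤ (4 * N) ^ m := by
  have hdvd : ∀ t : ℤ, ((h ^ k : ℕ) : ℤ) ∣ t * x j ^ k := fun t => by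
    push_cast
    rw [← hxj, ← abs_pow]
    exact Dvd.dvd.mul_left ((abs_dvd _ _).2 dvd_rfl) _
  have hx0 : x j ^ k ≠ 0 := pow_ne_zero _ fun h0 => by simp [h0] at hxj; omega
  have hspan : Ideal.span (Set.range fun i => x i ^ k) = ⊤ := by
    have := Ideal.span_pow_eq_top _ hx k
    rwa [← Set.range_comp] at this
  obtain ⟨b, hb⟩ := Ideal.mem_span_range_iff_exists_fun.1
    (show (1 : ℤ) ∈ Ideal.span (Set.range fun i => x i ^ k) by rw [hspan]; trivial)
  rw [Fin.sum_univ_succAbove _ j] at hb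
  have hbox := card_box_dvd_linearForm_le (h ^ k) N (by positivity) hN
    (fun i => x (j.succAbove i) ^ k) (fun i => b (j.succAbove i)) (by
      rw [← hb, sub_add_cancel_right]
      exact (hdvd _).neg_right)
  rw [Fintype.card_fin] at hbox
  refine le_trans (Nat.mul_le_mul_right _ ?_) hbox
  refine Set.ncard_le_ncard_of_injOn (fun a i => a (j.succAbove i)) ?_ ?_ ?_
  · rintro a ⟨h1, h2⟩
    refine ⟨fun i => h1 _, ?_⟩
    rw [Fin.sum_univ_succAbove _ j] at h2
    rw [eq_neg_of_add_eq_zero_right h2]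
    exact (hdvd _).neg_right
  · rintro a ⟨-, h2⟩ a' ⟨-, h2'⟩ haa
    have haa : ∀ i, a (j.succAbove i) = a' (j.succAbove i) := congrFun haa
    rw [Fin.sum_univ_succAbove _ j] at h2 h2'
    simp only [haa] at h2
    have := mul_right_cancel₀ hx0 (add_right_cancel (h2.trans h2'.symm))
    ext i
    rcases Fin.eq_self_or_eq_succAbove j i with rfl | ⟨i, rfl⟩
    · exact this
    · exact haa i
  · refine (Set.finite_Icc (fun _ => -(N : ℤ)) (fun _ => (N : ℤ))).subset ?_
    rintro a ⟨h1, -⟩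
    exact ⟨fun i => (abs_le.1 (h1 i)).1, fun i => (abs_le.1 (h1 i)).2⟩

/-- Every nonzero integer vector is a multiple of a primitive one. -/
lemma exists_primitive_of_ne_zero {ι : Type*} [Finite ι] (x : ι → ℤ) (hx : ∃ j, x j ≠ 0) :
    ∃ (g : ℤ) (z : ι → ℤ), g ≠ 0 ∧ (∀ i, x i = g * z i) ∧ Ideal.span (Set.range z) = ⊤ := by
  have := Fintype.ofFinite ι
  obtain ⟨g, hg⟩ := (IsPrincipalIdealRing.principal (Ideal.span (Set.range x))).principal
  have hmem : ∀ i, ∃ z, x i = g * z := fun i => by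
    have : x i ∈ Ideal.span (Set.range x) := Ideal.subset_span ⟨i, rfl⟩
    rw [hg] at this
    exact Ideal.mem_span_singleton.1 this
  choose z hz using hmem
  have hg0 : g ≠ 0 := by
    rintro rfl
    obtain ⟨j, hj⟩ := hx
    exact hj (by simp [hz])
  refine ⟨g, z, hg0, hz, ?_⟩
  rw [Ideal.eq_top_iff_one, Ideal.mem_span_range_iff_exists_fun]
  have hgm : g ∈ Ideal.span (Set.range x) := by
    rw [hg]; exact Ideal.mem_span_singleton_self g
  obtain ⟨b, hb⟩ := Ideal.mem_span_range_iff_exists_fun.1 hgm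
  refine ⟨b, mul_left_cancel₀ hg0 ?_⟩
  rw [mul_one, Finset.mul_sum]
  conv_rhs => rw [← hb]
  exact Finset.sum_congr rfl fun i _ => by rw [hz i]; ring

/-- The number of coefficient vectors of size at most `N` whose diagonal equation has a nontrivial
solution of size at most `M`. -/
lemma card_coeff_small_solution_le {m : ℕ} (k N M : ℕ) (hkm : k ≤ m) (hMN : M ^ k ≤ N) :
    {a : Fin (m + 1) → ℤ | (∀ i, |a i| ≤ N) ∧ ∃ x : Fin (m + 1) → ℤ, (∃ j, x j ≠ 0) ∧
      (∀ i, |x i| ≤ M) ∧ ∑ i, a i * x i ^ k = 0}.ncard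
      ≤ (m + 1) * (2 * 12 ^ m * N ^ m * M ^ (m + 1 - k)) := by
  classical
  let T : Fin (m + 1) → ℕ → Finset (Fin (m + 1) → ℤ) := fun j h =>
    (Fintype.piFinset fun i => if i = j then {(h : ℤ), -(h : ℤ)} else Finset.Icc (-(h : ℤ)) h).filter
      fun x => Ideal.span (Set.range x) = ⊤
  let V : (Fin (m + 1) → ℤ) → Set (Fin (m + 1) → ℤ) := fun x =>
    {a | (∀ i, |a i| ≤ N) ∧ ∑ i, a i * x i ^ k = 0}
  have hVfin : ∀ x, (V x).Finite := fun x => by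
    refine (Set.finite_Icc (fun _ => -(N : ℤ)) (fun _ => (N : ℤ))).subset ?_
    rintro a ⟨h1, -⟩
    exact ⟨fun i => (abs_le.1 (h1 i)).1, fun i => (abs_le.1 (h1 i)).2⟩
  have hTcard : ∀ j h, 0 < h → (T j h).card ≤ 2 * (3 * h) ^ m := fun j h hh => by
    refine (Finset.card_filter_le _ _).trans ?_
    rw [Fintype.card_piFinset, Fin.prod_univ_succAbove _ j]
    simp only [if_true, Fin.succAbove_ne, if_false, Finset.prod_const, Int.card_Icc,
      Finset.card_univ, Fintype.card_fin]
    refine Nat.mul_le_mul Finset.card_le_two (Nat.pow_le_pow_left ?_ _)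
    omega
  have hV : ∀ j, ∀ h ∈ Finset.Icc 1 M, ∀ x ∈ T j h, (V x).ncard * h ^ k ≤ (4 * N) ^ m := by
    intro j h hh x hx
    rw [Finset.mem_Icc] at hh
    rw [Finset.mem_filter, Fintype.mem_piFinset] at hx
    have hxj := hx.1 j
    refine card_coeff_of_primitive_le k N h hh.1 ((Nat.pow_le_pow_left hh.2 k).trans hMN) x j ?_ hx.2
    simp only [if_true, Finset.mem_insert, Finset.mem_singleton] at hxj
    rcases hxj with e | e <;> simp [e]
  have hsub : {a : Fin (m + 1) → ℤ | (∀ i, |a i| ≤ N) ∧ ∃ x : Fin (m + 1) → ℤ, (∃ j, x j ≠ 0) ∧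
      (∀ i, |x i| ≤ M) ∧ ∑ i, a i * x i ^ k = 0} ⊆
      ↑(Finset.univ.biUnion fun j => (Finset.Icc 1 M).biUnion fun h => (T j h).biUnion fun x =>
        (hVfin x).toFinset) := by
    rintro a ⟨ha, x, hx0, hxM, hsum⟩
    obtain ⟨g, z, hg, hz, hspan⟩ := exists_primitive_of_ne_zero x hx0
    obtain ⟨j, -, hj⟩ := Finset.exists_max_image Finset.univ (fun i => |z i|) ⟨0, Finset.mem_univ _⟩
    have hzj : z j ≠ 0 := by
      obtain ⟨i, hi⟩ := hx0
      intro h0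
      have := hj i (Finset.mem_univ _)
      rw [h0, abs_zero] at this
      exact hi (by rw [hz, abs_nonpos_iff.1 this, mul_zero])
    have hzM : |z j| ≤ M := by
      refine le_trans ?_ (hxM j)
      rw [hz, abs_mul]
      exact le_mul_of_one_le_left (abs_nonneg _) (Int.one_le_abs hg)
    simp only [Finset.coe_biUnion, Set.mem_iUnion, Finset.mem_coe, Set.Finite.mem_toFinset]
    refine ⟨j, Finset.mem_univ _, (z j).natAbs, ?_, z, ?_, ha, ?_⟩
    · rw [Finset.mem_Icc]
      exact ⟨Int.natAbs_pos.2 hzj, by rw [Int.abs_eq_natAbs] at hzM; exact_mod_cast hzM⟩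
    · rw [Finset.mem_filter, Fintype.mem_piFinset]
      refine ⟨fun i => ?_, hspan⟩
      split_ifs with hij
      · subst hij
        simp only [Finset.mem_insert, Finset.mem_singleton]
        omega
      · rw [Finset.mem_Icc, ← abs_le, Int.natCast_natAbs]
        exact hj i (Finset.mem_univ _)
    · refine mul_left_cancel₀ (pow_ne_zero k hg) ?_
      rw [mul_zero, ← hsum, Finset.mul_sum]
      exact Finset.sum_congr rfl fun i _ => by rw [hz i]; ring
  refine (Set.ncard_le_ncard hsub (Finset.finite_toSet _)).trans ?_
  rw [Set.ncard_coe_finset]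
  refine (Finset.card_biUnion_le_card_mul _ _ _ fun j _ => ?_).trans_eq
    (by rw [Finset.card_univ, Fintype.card_fin])
  have hlayer : ∀ h ∈ Finset.Icc 1 M, ((T j h).biUnion fun x => (hVfin x).toFinset).card
      ≤ 2 * 12 ^ m * N ^ m * M ^ (m - k) := by
    intro h hh
    have hh' := Finset.mem_Icc.1 hh
    have hpos : 0 < h ^ k := pow_pos hh'.1 k
    refine Nat.le_of_mul_le_mul_right ?_ hpos
    calc _ ≤ (∑ x ∈ T j h, (hVfin x).toFinset.card) * h ^ k :=
          Nat.mul_le_mul_right _ Finset.card_biUnion_le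
      _ = ∑ x ∈ T j h, (V x).ncard * h ^ k := by
          rw [Finset.sum_mul]
          exact Finset.sum_congr rfl fun x _ => by rw [Set.ncard_eq_toFinset_card _ (hVfin x)]
      _ ≤ (T j h).card * (4 * N) ^ m := Finset.sum_le_card_nsmul _ _ _ (hV j h hh)
      _ ≤ 2 * (3 * h) ^ m * (4 * N) ^ m := Nat.mul_le_mul_right _ (hTcard j h hh'.1)
      _ = 2 * 12 ^ m * N ^ m * h ^ (m - k) * h ^ k := by
          rw [mul_assoc _ (h ^ (m - k)), ← pow_add, Nat.sub_add_cancel hkm,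
            show 12 = 3 * 4 by norm_num]
          simp only [mul_pow]
          ring
      _ ≤ 2 * 12 ^ m * N ^ m * M ^ (m - k) * h ^ k := by
          gcongr
          exact hh'.2
  refine (Finset.card_biUnion_le_card_mul _ _ _ hlayer).trans_eq ?_
  rw [Nat.card_Icc, Nat.add_sub_cancel, Nat.sub_add_comm hkm, pow_succ]
  ring

/-- Theorem 1.4: for `s > 2k` and any `η > 0` there is `c > 0` such that the number of
coefficient vectors `a` with `|a| ≤ A` for which the equation has a nontrivial solution
with `0 < |x| ≤ c |a|^(1/(s-k))` is at most `η A^s`. -/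
theorem stmt_5 (k s : ℕ) (hk : 2 ≤ k) (hs : 2 * k < s) (η : ℝ) (hη : 0 < η) :
    ∃ c : ℝ, 0 < c ∧ ∀ A : ℝ, 1 ≤ A →
      (Nat.card {a : Fin s → ℤ | (∀ j, a j ≠ 0 ∧ (|a j| : ℝ) ≤ A) ∧
          ∃ x : Fin s → ℤ, (∃ j, x j ≠ 0) ∧
            (∀ j, (|x j| : ℝ) ≤
              c * ((Finset.univ.sup fun i => (a i).natAbs : ℕ) : ℝ) ^ ((1 : ℝ) / (s - k))) ∧
            ∑ j, a j * (x j) ^ k = 0} : ℝ)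
        ≤ η * A ^ s := by
  obtain ⟨m, rfl⟩ : ∃ m, s = m + 1 := ⟨s - 1, by omega⟩
  set K : ℝ := (m + 1) * (2 * 12 ^ m)
  have hK : 0 < K := by positivity
  have hc : 0 < min 1 (η / K) := lt_min one_pos (div_pos hη hK)
  refine ⟨min 1 (η / K), hc, fun A hA => ?_⟩
  set c := min 1 (η / K)
  have hA0 : 0 ≤ A := by linarith
  set N := ⌊A⌋₊
  have hNA : (N : ℝ) ≤ A := Nat.floor_le hA0
  set d := m + 1 - k
  have hd : ((m + 1 : ℕ) : ℝ) - k = d := by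
    rw [Nat.cast_sub (by omega : k ≤ m + 1)]
  have hd0 : d ≠ 0 := by omega
  have he : (0 : ℝ) ≤ 1 / d := by positivity
  set M := ⌊c * (N : ℝ) ^ ((1 : ℝ) / d)⌋₊
  have hMd : (M : ℝ) ^ d ≤ c * N := by
    calc (M : ℝ) ^ d ≤ (c * (N : ℝ) ^ ((1 : ℝ) / d)) ^ d := by
          gcongr
          exact Nat.floor_le (by positivity)
      _ = c ^ d * N := by
          rw [mul_pow, one_div, Real.rpow_inv_natCast_pow (by positivity) hd0]
      _ ≤ c * N := by
          gcongr
          exact pow_le_of_le_one hc.le (min_le_left _ _) hd0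
  have hMN : M ^ k ≤ N := by
    rcases Nat.eq_zero_or_pos M with h0 | h0
    · rw [h0, zero_pow (by omega)]
      exact Nat.zero_le _
    · refine (Nat.pow_le_pow_right h0 (by omega : k ≤ d)).trans ?_
      have : (M : ℝ) ^ d ≤ N := hMd.trans (mul_le_of_le_one_left (by positivity) (min_le_left _ _))
      exact_mod_cast this
  have hcount := card_coeff_small_solution_le (m := m) k N M (by omega) hMN
  have hsub : {a : Fin (m + 1) → ℤ | (∀ j, a j ≠ 0 ∧ (|a j| : ℝ) ≤ A) ∧
          ∃ x : Fin (m + 1) → ℤ, (∃ j, x j ≠ 0) ∧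
            (∀ j, (|x j| : ℝ) ≤ c * ((Finset.univ.sup fun i => (a i).natAbs : ℕ) : ℝ) ^
              ((1 : ℝ) / ((m + 1 : ℕ) - k))) ∧
            ∑ j, a j * (x j) ^ k = 0} ⊆
      {a : Fin (m + 1) → ℤ | (∀ i, |a i| ≤ N) ∧ ∃ x : Fin (m + 1) → ℤ, (∃ j, x j ≠ 0) ∧
        (∀ i, |x i| ≤ M) ∧ ∑ i, a i * x i ^ k = 0} := by
    rintro a ⟨ha, x, hx0, hx, hsum⟩
    have haN : ∀ i, (a i).natAbs ≤ N := fun i => by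
      refine Nat.le_floor ?_
      rw [Nat.cast_natAbs, Int.cast_abs]
      exact (ha i).2
    refine ⟨fun i => by rw [Int.abs_eq_natAbs]; exact_mod_cast haN i, x, hx0, fun i => ?_, hsum⟩
    have hxM : (x i).natAbs ≤ M := by
      refine Nat.le_floor ?_
      rw [Nat.cast_natAbs, Int.cast_abs]
      refine (hx i).trans ?_
      rw [hd]
      gcongr
      exact Finset.sup_le fun i _ => haN i
    rw [Int.abs_eq_natAbs]
    exact_mod_cast hxM
  have hfin : {a : Fin (m + 1) → ℤ | (∀ i, |a i| ≤ N) ∧ ∃ x : Fin (m + 1) → ℤ, (∃ j, x j ≠ 0) ∧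
        (∀ i, |x i| ≤ M) ∧ ∑ i, a i * x i ^ k = 0}.Finite := by
    refine (Set.finite_Icc (fun _ => -(N : ℤ)) (fun _ => (N : ℤ))).subset ?_
    rintro a ⟨h1, -⟩
    exact ⟨fun i => (abs_le.1 (h1 i)).1, fun i => (abs_le.1 (h1 i)).2⟩
  have hle := (Set.ncard_le_ncard hsub hfin).trans hcount
  rw [Nat.card_coe_set_eq]
  calc _ ≤ (((m + 1) * (2 * 12 ^ m * N ^ m * M ^ d) : ℕ) : ℝ) := by exact_mod_cast hle
    _ = K * N ^ m * (M : ℝ) ^ d := by push_cast; ring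
    _ ≤ K * N ^ m * (η / K * N) := by
        gcongr
        exact hMd.trans (by gcongr; exact min_le_right _ _)
    _ = η * (N : ℝ) ^ (m + 1) := by field_simp; ring
    _ ≤ η * A ^ (m + 1) := by gcongr
end

section
/- Let k ≥ 2 be an odd integer, s > k, and a ∈ (ℤ∖{0})^s. Then the singular integral J_a = ∫_{-∞}^{∞} ∏_{j=1}^s v(a_jβ) dβ, with v(β) = ∫_{-1}^{1} e(βξ^k)dξ, satisfies J_a ≫ (max_j |a_j|)^{-1}, with implied constant depending only on k and s. -/
open Real MeasureTheory
open scoped BigOperators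

noncomputable def ee (z : ℝ) : ℂ := Complex.exp (2 * Real.pi * Complex.I * z)

noncomputable def vv (k : ℕ) (β : ℝ) : ℂ := ∫ ξ in (-1 : ℝ)..1, ee (β * ξ ^ k)

lemma norm_ee (z : ℝ) : ‖ee z‖ = 1 := by
  rw [ee, show 2 * (Real.pi : ℂ) * Complex.I * z = ((2 * Real.pi * z : ℝ) : ℂ) * Complex.I by
    push_cast; ring]
  exact Complex.norm_exp_ofReal_mul_I _

@[fun_prop]
lemma continuous_ee : Continuous ee := by
  unfold ee; fun_prop

lemma ee_add (x y : ℝ) : ee (x + y) = ee x * ee y := by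
  simp only [ee, ← Complex.exp_add]
  congr 1
  push_cast
  ring

lemma ee_sum {ι : Type*} (t : Finset ι) (f : ι → ℝ) : ee (∑ i ∈ t, f i) = ∏ i ∈ t, ee (f i) := by
  simp only [ee, ← Complex.exp_sum]
  congr 1
  push_cast
  rw [Finset.mul_sum]

lemma norm_intervalIntegral_ee_le (c a b : ℝ) (k : ℕ) :
    ‖∫ ξ in a..b, ee (c * ξ ^ k)‖ ≤ |b - a| := by
  simpa using intervalIntegral.norm_integral_le_of_norm_le_const
    (a := a) (b := b) (f := fun ξ => ee (c * ξ ^ k)) (fun x _ => (norm_ee _).le)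

/-- The first derivative test for the phase `β ξ ^ (n + 1)` away from the origin. -/
lemma norm_integral_ee_pow_le (n : ℕ) {β l : ℝ} (hβ : β ≠ 0) (hl : 0 < l) (hl1 : l ≤ 1) :
    ‖∫ ξ in l..1, ee (β * ξ ^ (n + 1))‖ ≤ (l ^ n)⁻¹ / |β| := by
  have hpos : ∀ x ∈ Set.uIcc l 1, 0 < x := fun x hx => by
    rw [Set.uIcc_of_le hl1] at hx; exact hl.trans_le hx.1
  set c : ℂ := 2 * Real.pi * Complex.I * ((n + 1 : ℝ) * β : ℝ) with hc
  set g' : ℝ → ℝ := fun x => -(n * x ^ (n - 1)) / (x ^ n) ^ 2 with hg'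
  have hg : ∀ x ∈ Set.uIcc l 1, HasDerivAt (fun y : ℝ => (y ^ n)⁻¹) (g' x) x := fun x hx =>
    (hasDerivAt_pow n x).inv (pow_ne_zero _ (hpos x hx).ne')
  have hgc : ContinuousOn g' (Set.uIcc l 1) := by
    refine ContinuousOn.div (by fun_prop) (by fun_prop) fun x hx => ?_
    have := hpos x hx
    positivity
  have hgi : IntervalIntegrable g' volume l 1 := hgc.intervalIntegrable
  have he : ∀ x : ℝ, HasDerivAt (fun y : ℝ => ee (β * y ^ (n + 1)))
      (c * (x : ℂ) ^ n * ee (β * x ^ (n + 1))) x := by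
    intro x
    have h1 : HasDerivAt (fun y : ℝ => ((β * y ^ (n + 1) : ℝ) : ℂ))
        ((β * ((n + 1 : ℕ) * x ^ n) : ℝ) : ℂ) x :=
      ((hasDerivAt_pow (n + 1) x).const_mul β).ofReal_comp
    have h2 := (h1.const_mul (2 * Real.pi * Complex.I)).cexp
    refine h2.congr_deriv ?_
    rw [hc, ee]
    push_cast
    ring
  have hF : ∀ x ∈ Set.uIcc l 1,
      HasDerivAt (fun y : ℝ => ee (β * y ^ (n + 1)) * (((y ^ n)⁻¹ : ℝ) : ℂ))
        (c * ee (β * x ^ (n + 1)) + ee (β * x ^ (n + 1)) * (g' x : ℂ)) x := by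
    intro x hx
    refine ((he x).mul (hg x hx).ofReal_comp).congr_deriv ?_
    have : (x : ℂ) ^ n ≠ 0 := pow_ne_zero _ (by exact_mod_cast (hpos x hx).ne')
    push_cast
    field_simp
  have hi1 : IntervalIntegrable (fun x : ℝ => c * ee (β * x ^ (n + 1))) volume l 1 :=
    Continuous.intervalIntegrable (by fun_prop) _ _
  have hi2 : IntervalIntegrable (fun x : ℝ => ee (β * x ^ (n + 1)) * (g' x : ℂ)) volume l 1 := by
    refine ContinuousOn.intervalIntegrable (ContinuousOn.mul (by fun_prop) ?_)
    exact Complex.continuous_ofReal.comp_continuousOn hgc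
  have hftc := intervalIntegral.integral_eq_sub_of_hasDerivAt hF (hi1.add hi2)
  rw [intervalIntegral.integral_add hi1 hi2, intervalIntegral.integral_const_mul] at hftc
  have hrem : ‖∫ x in l..1, ee (β * x ^ (n + 1)) * (g' x : ℂ)‖ ≤ (l ^ n)⁻¹ - 1 := by
    have h1 := intervalIntegral.integral_eq_sub_of_hasDerivAt hg hgi
    have h2 := intervalIntegral.norm_integral_le_integral_norm (μ := volume)
      (f := fun x => ee (β * x ^ (n + 1)) * (g' x : ℂ)) hl1
    have h3 : ∫ x in l..1, ‖ee (β * x ^ (n + 1)) * (g' x : ℂ)‖ = ∫ x in l..1, - g' x := by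
      refine intervalIntegral.integral_congr fun x hx => ?_
      have hx0 := hpos x hx
      have : g' x ≤ 0 := by
        rw [hg']
        exact div_nonpos_of_nonpos_of_nonneg (neg_nonpos.2 (by positivity)) (by positivity)
      simp [norm_ee, abs_of_nonpos this]
    rw [h3, intervalIntegral.integral_neg, h1] at h2
    simpa using h2
  have hl0 : 0 < (l ^ n)⁻¹ := by positivity
  have hcn : ‖c‖ = 2 * Real.pi * ((n + 1) * |β|) := by
    rw [hc]
    simp only [norm_mul, Complex.norm_I, Complex.norm_real, Real.norm_eq_abs, Complex.norm_ofNat,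
      abs_of_pos Real.pi_pos]
    rw [abs_of_pos (by positivity : (0 : ℝ) < n + 1)]
    ring
  have hmain : ‖c‖ * ‖∫ ξ in l..1, ee (β * ξ ^ (n + 1))‖ ≤ 2 * (l ^ n)⁻¹ := by
    rw [← norm_mul, eq_sub_of_add_eq hftc]
    refine (norm_sub_le _ _).trans ?_
    have h4 : ‖ee (β * 1 ^ (n + 1)) * (((1 ^ n)⁻¹ : ℝ) : ℂ)
        - ee (β * l ^ (n + 1)) * (((l ^ n)⁻¹ : ℝ) : ℂ)‖ ≤ 1 + (l ^ n)⁻¹ := by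
      refine (norm_sub_le _ _).trans ?_
      rw [norm_mul, norm_mul, norm_ee, norm_ee, Complex.norm_real, Complex.norm_real,
        Real.norm_of_nonneg hl0.le]
      simp
    linarith
  have hβ' : 0 < |β| := abs_pos.2 hβ
  rw [le_div_iff₀ hβ']
  have hI := norm_nonneg (∫ ξ in l..1, ee (β * ξ ^ (n + 1)))
  have : 2 * |β| ≤ ‖c‖ := by
    rw [hcn]
    have h5 : 1 * |β| ≤ (n + 1) * |β| :=
      mul_le_mul_of_nonneg_right (by linarith [(Nat.cast_nonneg n : (0 : ℝ) ≤ n)]) hβ'.le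
    nlinarith [Real.pi_gt_three]
  nlinarith

lemma norm_integral_ee_zero_one_le {k : ℕ} (hk : k ≠ 0) {β : ℝ} (hβ : 1 ≤ |β|) :
    ‖∫ ξ in (0 : ℝ)..1, ee (β * ξ ^ k)‖ ≤ 2 * |β| ^ (-(1 / k : ℝ)) := by
  obtain ⟨n, rfl⟩ := Nat.exists_eq_succ_of_ne_zero hk
  have hβ0 : 0 < |β| := by linarith
  set l := |β| ^ (-(1 / (n + 1 : ℕ) : ℝ)) with hl
  have hl0 : 0 < l := Real.rpow_pos_of_pos hβ0 _
  have hl1 : l ≤ 1 := Real.rpow_le_one_of_one_le_of_nonpos hβ (by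
    rw [neg_nonpos]; positivity)
  have hlk : l ^ (n + 1) * |β| = 1 := by
    rw [hl, ← Real.rpow_natCast, ← Real.rpow_mul hβ0.le,
      show -(1 / (n + 1 : ℕ) : ℝ) * (n + 1 : ℕ) = -1 by push_cast; field_simp, Real.rpow_neg_one,
      inv_mul_cancel₀ hβ0.ne']
  have hii : ∀ a b : ℝ, IntervalIntegrable (fun ξ => ee (β * ξ ^ (n + 1))) volume a b :=
    fun a b => Continuous.intervalIntegrable (by fun_prop) _ _
  rw [Nat.succ_eq_add_one, ← intervalIntegral.integral_add_adjacent_intervals (hii 0 l) (hii l 1)]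
  refine (norm_add_le _ _).trans ?_
  have h1 := norm_intervalIntegral_ee_le β 0 l (n + 1)
  have h2 := norm_integral_ee_pow_le n (abs_pos.1 hβ0) hl0 hl1
  have h3 : (l ^ n)⁻¹ / |β| = l := by
    have : l ^ n ≠ 0 := by positivity
    field_simp
    rw [← hlk]; ring
  rw [h3] at h2
  rw [sub_zero, abs_of_pos hl0] at h1
  linarith

lemma norm_vv_le {k : ℕ} (hko : Odd k) {β : ℝ} (hβ : 1 ≤ |β|) :
    ‖vv k β‖ ≤ 4 * |β| ^ (-(1 / k : ℝ)) := by
  have hii : ∀ a b : ℝ, IntervalIntegrable (fun ξ => ee (β * ξ ^ k)) volume a b :=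
    fun a b => Continuous.intervalIntegrable (by fun_prop) _ _
  have hk : k ≠ 0 := hko.pos.ne'
  rw [vv, ← intervalIntegral.integral_add_adjacent_intervals (hii (-1) 0) (hii 0 1)]
  have h1 : ∫ ξ in (-1 : ℝ)..0, ee (β * ξ ^ k) = ∫ ξ in (0 : ℝ)..1, ee (-β * ξ ^ k) := by
    have := intervalIntegral.integral_comp_neg (a := 0) (b := 1) (fun ξ => ee (β * ξ ^ k))
    rw [neg_zero] at this
    rw [← this]
    simp [hko.neg_pow]
  rw [h1]
  have h2 := norm_integral_ee_zero_one_le hk hβ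
  have h3 := norm_integral_ee_zero_one_le hk (β := -β) (by rwa [abs_neg])
  rw [abs_neg] at h3
  exact (norm_add_le _ _).trans (by linarith)

lemma continuous_vv (k : ℕ) : Continuous (vv k) := by
  unfold vv
  exact intervalIntegral.continuous_parametric_intervalIntegral_of_continuous'
    (f := fun β ξ => ee (β * ξ ^ k)) (by unfold Function.uncurry; fun_prop) _ _

lemma norm_vv_mul_le {k : ℕ} (hko : Odd k) {c : ℝ} (hc : 1 ≤ |c|) (β : ℝ) :
    ‖vv k (c * β)‖ ≤ 8 * (1 + ‖β‖) ^ (-(1 / k : ℝ)) := by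
  have hk : (1 : ℝ) ≤ k := by exact_mod_cast hko.pos
  have hk1 : 1 / (k : ℝ) ≤ 1 := by rw [div_le_one (by linarith)]; exact hk
  have hk0 : 0 ≤ 1 / (k : ℝ) := by positivity
  have h2 : (1 / 2 : ℝ) ≤ 2 ^ (-(1 / k : ℝ)) := by
    have := Real.rpow_le_rpow_of_exponent_le (x := 2) (by norm_num) (neg_le_neg hk1)
    rw [Real.rpow_neg_one] at this
    linarith
  rw [Real.norm_eq_abs]
  rcases le_total |β| 1 with h | h
  · have h3 : ‖vv k (c * β)‖ ≤ 2 := by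
      have := norm_intervalIntegral_ee_le (c * β) (-1) 1 k
      norm_num at this
      exact this
    have h4 : (2 : ℝ) ^ (-(1 / k : ℝ)) ≤ (1 + |β|) ^ (-(1 / k : ℝ)) :=
      Real.rpow_le_rpow_of_nonpos (by positivity) (by linarith) (by linarith)
    linarith
  · have hβ : |β| ≤ |c * β| := by
      rw [abs_mul]; exact le_mul_of_one_le_left (abs_nonneg _) hc
    have h3 := norm_vv_le hko (h.trans hβ)
    have h4 : |c * β| ^ (-(1 / k : ℝ)) ≤ |β| ^ (-(1 / k : ℝ)) :=
      Real.rpow_le_rpow_of_nonpos (by linarith) hβ (by linarith)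
    have h5 : (2 : ℝ) ^ (-(1 / k : ℝ)) * |β| ^ (-(1 / k : ℝ)) ≤ (1 + |β|) ^ (-(1 / k : ℝ)) := by
      rw [← Real.mul_rpow (by norm_num) (abs_nonneg _)]
      exact Real.rpow_le_rpow_of_nonpos (by positivity) (by linarith) (by linarith)
    have h6 : (1 / 2 : ℝ) * |β| ^ (-(1 / k : ℝ)) ≤ 2 ^ (-(1 / k : ℝ)) * |β| ^ (-(1 / k : ℝ)) :=
      mul_le_mul_of_nonneg_right h2 (by positivity)
    linarith

lemma integrable_prod_vv {k : ℕ} (hko : Odd k) {ι : Type*} [Fintype ι]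
    (hs : k < Fintype.card ι) {a : ι → ℝ} (ha : ∀ j, 1 ≤ |a j|) :
    Integrable fun β : ℝ => ∏ j, vv k (a j * β) := by
  have hk : (0 : ℝ) < k := by exact_mod_cast hko.pos
  have hr : ((Module.finrank ℝ ℝ : ℕ) : ℝ) < (Fintype.card ι : ℝ) / k := by
    rw [Module.finrank_self, Nat.cast_one, lt_div_iff₀ hk, one_mul]
    exact_mod_cast hs
  refine ((integrable_one_add_norm (μ := (volume : Measure ℝ)) hr).const_mul
    (8 ^ Fintype.card ι)).mono' ?_ (.of_forall fun β => ?_)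
  · exact (continuous_finsetProd _ fun j _ =>
      (continuous_vv k).comp (continuous_const.mul continuous_id)).aestronglyMeasurable
  · rw [norm_prod]
    refine (Finset.prod_le_prod (fun _ _ => norm_nonneg _)
      fun j _ => norm_vv_mul_le hko (ha j) β).trans_eq ?_
    rw [Finset.prod_const, Finset.card_univ, mul_pow, ← Real.rpow_natCast (_ ^ _),
      ← Real.rpow_mul (by positivity)]
    congr 2
    ring

lemma integral_ee_mul_gaussian {b : ℝ} (hb : 0 < b) (g : ℝ) :
    ∫ β : ℝ, ee (β * g) * Complex.exp (-b * β ^ 2)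
      = ((√(π / b) * Real.exp (-(π * g) ^ 2 / b) : ℝ) : ℂ) := by
  have h := fourierIntegral_gaussian (b := (b : ℂ)) (by simpa using hb) ((2 * π * g : ℝ) : ℂ)
  have h1 : ∀ β : ℝ, ee (β * g) = Complex.exp (Complex.I * ((2 * π * g : ℝ) : ℂ) * β) := by
    intro β
    rw [ee]; congr 1; push_cast; ring
  simp only [h1]
  rw [h, Real.sqrt_eq_rpow]
  push_cast
  rw [Complex.ofReal_cpow (by positivity)]
  push_cast
  congr 2
  have : (b : ℂ) ≠ 0 := by exact_mod_cast hb.ne'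
  field_simp
  ring

lemma re_integral_characteristic_mul_gaussian_ge {X : Type*} [MeasurableSpace X] (μ : Measure X)
    [IsFiniteMeasure μ] {G : X → ℝ} (hG : Measurable G) {b : ℝ} (hb : 0 < b) :
    √(π / b) * Real.exp (-1) * μ.real {x | |G x| ≤ √b / π}
      ≤ (∫ β : ℝ, (∫ x, ee (β * G x) ∂μ) * Complex.exp (-b * β ^ 2)).re := by
  have hii : Integrable (Function.uncurry fun (β : ℝ) (x : X) =>
      ee (β * G x) * Complex.exp (-b * β ^ 2)) (volume.prod μ) := by
    have h1 : Integrable (fun z : ℝ × X => Complex.exp (-b * (z.1 : ℂ) ^ 2)) (volume.prod μ) := by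
      simpa using (integrable_cexp_neg_mul_sq (b := (b : ℂ)) (by simpa using hb)).mul_prod
        (integrable_const (μ := μ) (1 : ℂ))
    refine h1.bdd_mul (c := 1) ?_ (.of_forall fun z => (norm_ee _).le)
    exact (continuous_ee.measurable.comp
      (measurable_fst.mul (hG.comp measurable_snd))).aestronglyMeasurable
  have h2 : ∫ β : ℝ, (∫ x, ee (β * G x) ∂μ) * Complex.exp (-b * β ^ 2)
      = ((∫ x, √(π / b) * Real.exp (-(π * G x) ^ 2 / b) ∂μ : ℝ) : ℂ) := by
    simp only [← integral_mul_const]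
    rw [integral_integral_swap hii]
    simp only [integral_ee_mul_gaussian hb]
    exact integral_ofReal
  rw [h2, Complex.ofReal_re, integral_const_mul, mul_assoc]
  refine mul_le_mul_of_nonneg_left ?_ (Real.sqrt_nonneg _)
  have hS : MeasurableSet {x | |G x| ≤ √b / π} :=
    measurableSet_le (continuous_abs.measurable.comp hG) measurable_const
  have hmeas : Measurable fun x => Real.exp (-(π * G x) ^ 2 / b) := by fun_prop
  have hi : Integrable (fun x => Real.exp (-(π * G x) ^ 2 / b)) μ := by
    refine Integrable.of_bound hmeas.aestronglyMeasurable 1 (.of_forall fun x => ?_)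
    rw [Real.norm_of_nonneg (Real.exp_nonneg _), Real.exp_le_one_iff]
    exact div_nonpos_of_nonpos_of_nonneg (neg_nonpos.2 (sq_nonneg _)) hb.le
  calc Real.exp (-1) * μ.real {x | |G x| ≤ √b / π}
      = ∫ x in {x | |G x| ≤ √b / π}, Real.exp (-1) ∂μ := by
        rw [setIntegral_const, smul_eq_mul, mul_comm]
    _ ≤ ∫ x in {x | |G x| ≤ √b / π}, Real.exp (-(π * G x) ^ 2 / b) ∂μ := by
        refine setIntegral_mono_on (integrable_const _).integrableOn hi.integrableOn hS
          fun x hx => ?_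
        rw [Real.exp_le_exp, le_div_iff₀ hb]
        have h3 : |π * G x| ≤ √b := by
          rw [abs_mul, abs_of_pos Real.pi_pos, mul_comm]
          exact (le_div_iff₀ Real.pi_pos).1 hx
        have h4 := pow_le_pow_left₀ (abs_nonneg _) h3 2
        rw [sq_abs, Real.sq_sqrt hb.le] at h4
        linarith
    _ ≤ ∫ x, Real.exp (-(π * G x) ^ 2 / b) ∂μ :=
        setIntegral_le_integral hi (.of_forall fun x => (Real.exp_nonneg _))

/-- If the characteristic function of `G` is integrable, its integral (the density of `G` at `0`)
is bounded below by the measure of small sublevel sets of `|G|`. -/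
lemma re_integral_characteristic_ge {X : Type*} [MeasurableSpace X] (μ : Measure X)
    [IsFiniteMeasure μ] {G : X → ℝ} (hG : Measurable G) {c δ₀ : ℝ} (hδ₀ : 0 < δ₀)
    (hc : ∀ δ, 0 < δ → δ ≤ δ₀ → c * δ ≤ μ.real {x | |G x| ≤ δ})
    (hφ : Integrable fun β : ℝ => ∫ x, ee (β * G x) ∂μ) :
    c * (Real.exp (-1) / √π) ≤ (∫ β : ℝ, ∫ x, ee (β * G x) ∂μ).re := by
  have hlim : Filter.Tendsto
      (fun b : ℝ => ∫ β : ℝ, (∫ x, ee (β * G x) ∂μ) * Complex.exp (-b * β ^ 2))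
      (nhdsWithin 0 (Set.Ioi 0)) (nhds (∫ β : ℝ, ∫ x, ee (β * G x) ∂μ)) := by
    refine tendsto_integral_filter_of_dominated_convergence
      (fun β => ‖∫ x, ee (β * G x) ∂μ‖) (.of_forall fun b => ?_) ?_ hφ.norm
      (.of_forall fun β => ?_)
    · exact hφ.aestronglyMeasurable.mul
        (Continuous.aestronglyMeasurable (by fun_prop))
    · filter_upwards [self_mem_nhdsWithin] with b hb
      refine .of_forall fun β => ?_
      rw [norm_mul]
      refine mul_le_of_le_one_right (norm_nonneg _) ?_
      rw [show -(b : ℂ) * (β : ℂ) ^ 2 = ((-b * β ^ 2 : ℝ) : ℂ) by push_cast; ring,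
        Complex.norm_exp_ofReal, Real.exp_le_one_iff]
      have : 0 < b := hb
      nlinarith [mul_nonneg this.le (sq_nonneg β)]
    · have h : Continuous fun b : ℝ => (∫ x, ee (β * G x) ∂μ) * Complex.exp (-b * β ^ 2) := by
        fun_prop
      simpa using (h.tendsto 0).mono_left nhdsWithin_le_nhds
  refine ge_of_tendsto ((Complex.continuous_re.tendsto _).comp hlim) ?_
  have hev : ∀ᶠ b : ℝ in nhdsWithin 0 (Set.Ioi 0), √b / π < δ₀ := by
    have h : Continuous fun b : ℝ => √b / π := by fun_prop
    have h0 := (h.tendsto 0).mono_left (nhdsWithin_le_nhds (s := Set.Ioi 0))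
    rw [Real.sqrt_zero, zero_div] at h0
    exact h0.eventually_lt_const hδ₀
  filter_upwards [self_mem_nhdsWithin, hev] with b hb hbδ
  have hb : 0 < b := hb
  refine le_trans ?_ (re_integral_characteristic_mul_gaussian_ge μ hG hb)
  refine le_trans (le_of_eq ?_) (mul_le_mul_of_nonneg_left
    (hc (√b / π) (by positivity) hbδ.le) (by positivity))
  rw [Real.sqrt_div Real.pi_pos.le]
  have h1 : √b ≠ 0 := by positivity
  have h2 : √π ≠ 0 := by positivity
  field_simp
  rw [Real.sq_sqrt Real.pi_pos.le]

lemma le_volume_abs_mul_pow_add_le {k : ℕ} (hko : Odd k) {α t δ : ℝ} (hα : α ≠ 0)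
    (ht : |t| ≤ |α|) (hδ : 0 < δ) (hδα : δ ≤ |α|) :
    ENNReal.ofReal (δ / (k * |α|)) ≤
      volume.restrict (Set.Ioc (-1 : ℝ) 1) {x | |α * x ^ k + t| ≤ δ} := by
  have hα0 : 0 < |α| := abs_pos.2 hα
  have hk : (1 : ℝ) ≤ k := by exact_mod_cast hko.pos
  set r := δ / (k * |α|) with hr
  have hr0 : 0 < r := by positivity
  have hr1 : r ≤ 1 := by
    rw [hr, div_le_one (by positivity)]
    nlinarith
  obtain ⟨x₀, hx₀, hx₀k⟩ : ∃ x ∈ Set.Icc (-1 : ℝ) 1, x ^ k = -t / α := by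
    have hu : |-t / α| ≤ 1 := by
      rw [abs_div, abs_neg, div_le_one hα0]; exact ht
    refine intermediate_value_Icc (f := fun x : ℝ => x ^ k) (by norm_num) (by fun_prop) ?_
    simpa [hko.neg_one_pow] using abs_le.1 hu
  have hnear : ∀ x ∈ Set.Icc (-1 : ℝ) 1, |x - x₀| ≤ r → |α * x ^ k + t| ≤ δ := by
    intro x hx hxr
    have h1 : α * x ^ k + t = α * (x ^ k - x₀ ^ k) := by
      rw [hx₀k]; field_simp; ring
    have h2 := abs_pow_sub_pow_le x x₀ k
    have h3 : max |x| |x₀| ^ (k - 1) ≤ 1 :=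
      pow_le_one₀ (by positivity) (max_le (abs_le.2 hx) (abs_le.2 hx₀))
    have h4 : |x ^ k - x₀ ^ k| ≤ r * k :=
      h2.trans ((mul_le_of_le_one_right (by positivity) h3).trans (by gcongr))
    rw [h1, abs_mul]
    calc |α| * |x ^ k - x₀ ^ k| ≤ |α| * (r * k) := by gcongr
      _ = δ := by rw [hr]; field_simp
  obtain ⟨y, hy1, hy2, hy3, hy4⟩ : ∃ y, -1 ≤ y ∧ y + r ≤ 1 ∧ x₀ - r ≤ y ∧ y ≤ x₀ := by
    rcases le_total x₀ 0 with h | h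
    · exact ⟨x₀, hx₀.1, by linarith, by linarith, le_rfl⟩
    · exact ⟨x₀ - r, by linarith, by linarith [hx₀.2], le_rfl, by linarith⟩
  have hsub : Set.Ioc y (y + r) ⊆ Set.Ioc (-1 : ℝ) 1 := Set.Ioc_subset_Ioc hy1 hy2
  calc ENNReal.ofReal r = volume (Set.Ioc y (y + r)) := by rw [Real.volume_Ioc]; congr 1; ring
    _ = volume.restrict (Set.Ioc (-1 : ℝ) 1) (Set.Ioc y (y + r)) := by
        rw [Measure.restrict_apply measurableSet_Ioc, Set.inter_eq_left.2 hsub]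
    _ ≤ _ := measure_mono fun x hx => by
        refine hnear x (Set.Ioc_subset_Icc_self (hsub hx)) (abs_le.2 ⟨?_, ?_⟩) <;>
          linarith [hx.1, hx.2]

lemma le_measureReal_abs_diagonal_form_le {k : ℕ} (hko : Odd k) {ι : Type*} [Fintype ι]
    {α : ℝ} (hα : α ≠ 0) {a : ι → ℝ} (ha : ∀ j, |a j| ≤ |α|) {η : ℝ} (hη : 0 < η) (hη1 : η ≤ 1)
    (hηι : Fintype.card ι * η ≤ 1) {δ : ℝ} (hδ : 0 < δ) (hδα : δ ≤ |α|) :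
    η ^ Fintype.card ι / (k * |α|) * δ ≤
      ((Measure.pi fun _ : ι => volume.restrict (Set.Ioc (-1 : ℝ) 1)).prod
        (volume.restrict (Set.Ioc (-1 : ℝ) 1))).real
        {z : (ι → ℝ) × ℝ | |α * z.2 ^ k + ∑ j, a j * z.1 j ^ k| ≤ δ} := by
  set ν := volume.restrict (Set.Ioc (-1 : ℝ) 1) with hν
  have hS : MeasurableSet {z : (ι → ℝ) × ℝ | |α * z.2 ^ k + ∑ j, a j * z.1 j ^ k| ≤ δ} :=
    measurableSet_le (Continuous.measurable (by fun_prop)) measurable_const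
  rw [measureReal_def]
  refine (ENNReal.ofReal_le_iff_le_toReal (measure_ne_top _ _)).1 ?_
  rw [Measure.prod_apply hS]
  set B : Set (ι → ℝ) := Set.univ.pi fun _ => Set.Ioc 0 η with hB
  have hBm : MeasurableSet B := MeasurableSet.univ_pi fun _ => measurableSet_Ioc
  have hBν : Measure.pi (fun _ : ι => ν) B = ENNReal.ofReal (η ^ Fintype.card ι) := by
    have : ν (Set.Ioc 0 η) = ENNReal.ofReal η := by
      rw [hν, Measure.restrict_apply measurableSet_Ioc,
        Set.inter_eq_left.2 (Set.Ioc_subset_Ioc (by norm_num) hη1), Real.volume_Ioc, sub_zero]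
    rw [hB, Measure.pi_pi, this, Finset.prod_const, Finset.card_univ, ENNReal.ofReal_pow hη.le]
  have hslice : ∀ y ∈ B, ENNReal.ofReal (δ / (k * |α|)) ≤
      ν (Prod.mk y ⁻¹' {z : (ι → ℝ) × ℝ | |α * z.2 ^ k + ∑ j, a j * z.1 j ^ k| ≤ δ}) := by
    intro y hy
    change _ ≤ ν {x | |α * x ^ k + ∑ j, a j * y j ^ k| ≤ δ}
    refine le_volume_abs_mul_pow_add_le hko hα ?_ hδ hδα
    calc |∑ j, a j * y j ^ k| ≤ ∑ j, |a j * y j ^ k| := Finset.abs_sum_le_sum_abs _ _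
      _ ≤ ∑ _j : ι, |α| * η := by
          refine Finset.sum_le_sum fun j _ => ?_
          obtain ⟨hy0, hy1⟩ := hy j (Set.mem_univ j)
          rw [abs_mul, abs_of_nonneg (pow_nonneg hy0.le k)]
          refine mul_le_mul (ha j) ?_ (pow_nonneg hy0.le k) (abs_nonneg _)
          exact (pow_le_of_le_one hy0.le (hy1.trans hη1) hko.pos.ne').trans hy1
      _ = |α| * (Fintype.card ι * η) := by
          rw [Finset.sum_const, Finset.card_univ, nsmul_eq_mul]; ring
      _ ≤ |α| := mul_le_of_le_one_right (abs_nonneg _) hηι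
  calc ENNReal.ofReal (η ^ Fintype.card ι / (k * |α|) * δ)
      = ENNReal.ofReal (δ / (k * |α|)) * Measure.pi (fun _ : ι => ν) B := by
        rw [hBν, ← ENNReal.ofReal_mul (by positivity)]
        congr 1
        ring
    _ = ∫⁻ _ in B, ENNReal.ofReal (δ / (k * |α|)) ∂Measure.pi (fun _ : ι => ν) :=
        (setLIntegral_const _ _).symm
    _ ≤ ∫⁻ y in B, ν (Prod.mk y ⁻¹' {z : (ι → ℝ) × ℝ |
          |α * z.2 ^ k + ∑ j, a j * z.1 j ^ k| ≤ δ}) ∂Measure.pi (fun _ : ι => ν) :=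
        setLIntegral_mono' hBm hslice
    _ ≤ _ := setLIntegral_le_lintegral _ _

lemma integral_ee_diagonal_form (k : ℕ) {ι : Type*} [Fintype ι] (α : ℝ) (a : ι → ℝ) (β : ℝ) :
    ∫ z : (ι → ℝ) × ℝ, ee (β * (α * z.2 ^ k + ∑ j, a j * z.1 j ^ k))
      ∂((Measure.pi fun _ : ι => volume.restrict (Set.Ioc (-1 : ℝ) 1)).prod
        (volume.restrict (Set.Ioc (-1 : ℝ) 1)))
      = vv k (α * β) * ∏ j, vv k (a j * β) := by
  have hvv : ∀ c : ℝ, vv k (c * β) = ∫ x in Set.Ioc (-1 : ℝ) 1, ee (β * (c * x ^ k)) := by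
    intro c
    rw [vv, intervalIntegral.integral_of_le (by norm_num)]
    congr 1 with x
    congr 1
    ring
  simp only [hvv, ← integral_fintype_prod_eq_prod]
  rw [mul_comm, ← integral_prod_mul]
  congr 1 with z
  rw [mul_add, ee_add, Finset.mul_sum, ee_sum, mul_comm]

/-- For `k` odd and `s > k`, the singular integral `J_a` (a real number) satisfies
`J_a ≫ |a|⁻¹` where `|a| = max |a_j|`, uniformly in `a ∈ (ℤ∖{0})^s`. -/
theorem stmt_12 (k s : ℕ) (hk : 2 ≤ k) (hko : Odd k) (hs : k < s) :
    ∃ C : ℝ, 0 < C ∧ ∀ a : Fin s → ℤ, (∀ j, a j ≠ 0) →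
      C * (((Finset.univ.sup fun j => (a j).natAbs : ℕ) : ℝ))⁻¹
        ≤ (∫ β : ℝ, ∏ j, vv k ((a j : ℝ) * β)).re := by
  have hs0 : (1 : ℝ) ≤ s := by exact_mod_cast (by omega : 1 ≤ s)
  have hk0 : (0 : ℝ) < k := by exact_mod_cast hko.pos
  refine ⟨(1 / s : ℝ) ^ (s - 1) / k * (Real.exp (-1) / √π), by positivity, fun a ha => ?_⟩
  have : Nonempty (Fin s) := ⟨⟨0, by omega⟩⟩
  obtain ⟨m, -, hm⟩ := Finset.exists_mem_eq_sup Finset.univ Finset.univ_nonempty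
    fun j => (a j).natAbs
  have habs : ∀ j, |(a j : ℝ)| = ((a j).natAbs : ℝ) := fun j => by
    rw [Nat.cast_natAbs, Int.cast_abs]
  have hmax : ∀ j, |(a j : ℝ)| ≤ |(a m : ℝ)| := fun j => by
    rw [habs, habs, ← hm]
    exact_mod_cast Finset.le_sup (f := fun j => (a j).natAbs) (Finset.mem_univ j)
  have hm0 : (a m : ℝ) ≠ 0 := by exact_mod_cast ha m
  have hcard : Fintype.card {j // j ≠ m} = s - 1 := by simp [Fintype.card_subtype_compl]
  have hφ : (fun β : ℝ => ∏ j, vv k ((a j : ℝ) * β)) = fun β =>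
      ∫ z : ({j // j ≠ m} → ℝ) × ℝ,
        ee (β * ((a m : ℝ) * z.2 ^ k + ∑ j : {j // j ≠ m}, (a j : ℝ) * z.1 j ^ k))
        ∂((Measure.pi fun _ : {j // j ≠ m} => volume.restrict (Set.Ioc (-1 : ℝ) 1)).prod
          (volume.restrict (Set.Ioc (-1 : ℝ) 1))) := by
    funext β
    rw [integral_ee_diagonal_form k (a m : ℝ) (fun j : {j // j ≠ m} => (a j : ℝ)),
      Fintype.prod_eq_mul_prod_subtype_ne _ m]
  have hii : Integrable fun β : ℝ => ∏ j, vv k ((a j : ℝ) * β) :=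
    integrable_prod_vv hko (by simpa using hs) fun j => by
      exact_mod_cast Int.one_le_abs (ha j)
  rw [hφ] at hii ⊢
  have key := re_integral_characteristic_ge _ (Continuous.measurable (by fun_prop))
    (abs_pos.2 hm0) (fun δ hδ hδα => le_measureReal_abs_diagonal_form_le hko hm0
      (fun j : {j // j ≠ m} => hmax j) (η := 1 / s) (by positivity)
      (by rw [div_le_one (by linarith)]; exact hs0) (by
        rw [mul_one_div, div_le_one (by linarith)]
        exact_mod_cast (hcard.trans_le (Nat.sub_le _ _))) hδ hδα) hii
  refine le_trans (le_of_eq ?_) key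
  rw [hm, hcard, habs]
  field_simp
end
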